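/- arXiv:2003.09239 — 2 statements merged into one kernel-verified Lean document; each statement's English description precedes it below -/
import Mathlib

section
/- Let σ > 0. Then there exists a constant C = C(σ) > 0 such that for all t > 0 and all x ∈ ℝⁿ, |𝓕^{−1}( e^{−t/2} L_σ(t,·) ψ̂(2^{2/σ}·) )(x)| ≤ C t ⟨x⟩^{−n−σ} if t ≤ 1, and |𝓕^{−1}( e^{−t/2} L_σ(t,·) ψ̂(2^{2/σ}·) )(x)| ≤ C t^{−n/σ} ⟨t^{−1/σ} x⟩^{−n−σ} if t ≥ 1. -/
open MeasureTheory Real Filter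
open scoped ENNReal RealInnerProductSpace

noncomputable section

abbrev Rn (n : ℕ) := EuclideanSpace ℝ (Fin n)

/-- Fourier transform `f̂(ξ) = ∫ f(x) e^{-i x·ξ} dx`. -/
def FT (n : ℕ) (f : Rn n → ℂ) (ξ : Rn n) : ℂ :=
  ∫ x, f x * Complex.exp (-(Complex.I * (⟪x, ξ⟫ : ℝ)))

/-- Inverse Fourier transform `(2π)^{-n} ∫ f(ξ) e^{i ξ·x} dξ`. -/
def IFT (n : ℕ) (f : Rn n → ℂ) (x : Rn n) : ℂ :=
  (((2 * Real.pi) ^ n : ℝ)⁻¹ : ℂ) * ∫ ξ, f ξ * Complex.exp (Complex.I * (⟪ξ, x⟫ : ℝ))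

/-- The multiplier `L_σ(t,ξ)`. -/
def Lsig {n : ℕ} (σ t : ℝ) (ξ : Rn n) : ℝ :=
  if ‖ξ‖ < (2:ℝ) ^ (-(2/σ)) then
    Real.sinh (t * Real.sqrt (1/4 - ‖ξ‖ ^ σ)) / Real.sqrt (1/4 - ‖ξ‖ ^ σ)
  else
    Real.sin (t * Real.sqrt (‖ξ‖ ^ σ - 1/4)) / Real.sqrt (‖ξ‖ ^ σ - 1/4)

/-- Japanese bracket `⟨x⟩ = (1+|x|²)^{1/2}`. -/
def jap {n : ℕ} (x : Rn n) : ℝ := Real.sqrt (1 + ‖x‖ ^ 2)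

def lfS (z : ℂ) : ℂ := ∑' k : ℕ, z ^ k / ((2 * k + 1).factorial : ℂ)

def lfG (t : ℝ) (w : ℂ) : ℂ :=
  ((Real.exp (-(t/2)) * t : ℝ) : ℂ) * lfS ((t:ℂ) ^ 2 * (1/4 - w))

lemma lfS_sq (z : ℂ) : z * lfS (z ^ 2) = Complex.sinh z := by
  rw [lfS, ← tsum_mul_left, ← (Complex.hasSum_sinh z).tsum_eq]
  congr 1; ext k
  rw [← pow_mul]; ring

lemma lfS_zero : lfS 0 = 1 := by
  rw [lfS, tsum_eq_single 0]
  · simp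
  · intro k hk; simp [hk]

lemma lfS_diff : Differentiable ℂ lfS := by
  intro z
  have hR : z ∈ Metric.ball (0:ℂ) (‖z‖ + 1) := by simp
  have hs : Summable (fun k : ℕ => (‖z‖ + 1) ^ k / (k.factorial : ℝ)) :=
    Real.summable_pow_div_factorial _
  have := Complex.differentiableOn_tsum_of_summable_norm (F := fun (k : ℕ) (z : ℂ) => z ^ k / ((2 * k + 1).factorial : ℂ)) hs (U := Metric.ball (0:ℂ) (‖z‖ + 1))
    (fun i => by fun_prop) Metric.isOpen_ball ?_
  · exact this.differentiableAt (Metric.isOpen_ball.mem_nhds hR)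
  · intro i w hw
    simp only [Metric.mem_ball, dist_zero_right] at hw
    rw [norm_div, norm_pow, Complex.norm_natCast]
    have h2 : (i.factorial : ℝ) ≤ ((2 * i + 1).factorial : ℝ) := by
      exact_mod_cast Nat.factorial_le (by omega)
    have h3 : (0:ℝ) < i.factorial := by positivity
    gcongr

lemma lfG_diff (t : ℝ) : Differentiable ℂ (lfG t) := by
  unfold lfG
  exact (lfS_diff.comp (by fun_prop : Differentiable ℂ (fun w : ℂ => (t:ℂ)^2 * (1/4 - w)))).const_mul _

lemma norm_cosh_le (z : ℂ) : ‖Complex.cosh z‖ ≤ Real.exp |z.re| := by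
  rw [Complex.cosh, norm_div]
  have h1 := norm_add_le (Complex.exp z) (Complex.exp (-z))
  rw [Complex.norm_exp, Complex.norm_exp, Complex.neg_re] at h1
  have h2 := Real.exp_le_exp.2 (le_abs_self z.re)
  have h3 := Real.exp_le_exp.2 (neg_le_abs z.re)
  simp only [Complex.norm_ofNat]
  linarith

lemma norm_sinh_le (z : ℂ) : ‖Complex.sinh z‖ ≤ Real.exp |z.re| := by
  rw [Complex.sinh, norm_div]
  have h1 := norm_sub_le (Complex.exp z) (Complex.exp (-z))
  rw [Complex.norm_exp, Complex.norm_exp, Complex.neg_re] at h1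
  have h2 := Real.exp_le_exp.2 (le_abs_self z.re)
  have h3 := Real.exp_le_exp.2 (neg_le_abs z.re)
  simp only [Complex.norm_ofNat]
  linarith

lemma norm_sinh_le' (z : ℂ) : ‖Complex.sinh z‖ ≤ ‖z‖ * Real.exp |z.re| := by
  have hd : ∀ x ∈ Set.Icc (0:ℝ) 1, HasDerivWithinAt (fun x : ℝ => Complex.sinh (x * z))
      (Complex.cosh (x * z) * z) (Set.Icc 0 1) x := by
    intro x hx
    have : HasDerivAt (fun x : ℂ => Complex.sinh (x * z)) (Complex.cosh (x * z) * (1 * z)) (x:ℂ) :=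
      ((hasDerivAt_id (x:ℂ)).mul_const z).csinh
    rw [one_mul] at this
    exact this.comp_ofReal.hasDerivWithinAt
  have := Convex.norm_image_sub_le_of_norm_hasDerivWithin_le (C := ‖z‖ * Real.exp |z.re|) hd ?_
    (convex_Icc 0 1) (Set.left_mem_Icc.2 zero_le_one) (Set.right_mem_Icc.2 zero_le_one)
  · simpa using this
  · intro x hx
    rw [norm_mul, mul_comm]
    gcongr
    refine (norm_cosh_le _).trans (Real.exp_le_exp.2 ?_)
    simp only [Complex.mul_re, Complex.ofReal_re, Complex.ofReal_im, zero_mul, sub_zero]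
    rw [abs_mul, abs_of_nonneg hx.1]
    exact mul_le_of_le_one_left (abs_nonneg _) hx.2

lemma cosh_sub_bound (u w : ℂ) (h : u ^ 2 = 1/4 - w) (h0 : 0 ≤ u.re) (h1 : u.re ≤ 1/2)
    (s : ℝ) (hs : 0 ≤ s) :
    ‖Complex.cosh (s * u) - Complex.cosh (s * (1/2))‖ ≤ 2 * s * ‖w‖ * Real.exp (s / 2) := by
  have e : Complex.cosh (s * u) - Complex.cosh (s * (1/2)) =
      2 * Complex.sinh (s * (u + 1/2) / 2) * Complex.sinh (s * (u - 1/2) / 2) := by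
    have e1 : (s:ℂ) * u = s * (u + 1/2) / 2 + s * (u - 1/2) / 2 := by ring
    have e2 : (s:ℂ) * (1/2) = s * (u + 1/2) / 2 - s * (u - 1/2) / 2 := by ring
    rw [e1, e2, Complex.cosh_add, Complex.cosh_sub]; ring
  have b1 := norm_sinh_le (s * (u + 1/2) / 2)
  have b2 := norm_sinh_le' (s * (u - 1/2) / 2)
  have r1 : ((s:ℂ) * (u + 1/2) / 2).re = s * (u.re + 1/2) / 2 := by
    simp [Complex.mul_re]
  have r2 : ((s:ℂ) * (u - 1/2) / 2).re = s * (u.re - 1/2) / 2 := by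
    simp [Complex.mul_re]
  rw [r1, abs_of_nonneg (by positivity)] at b1
  rw [r2, abs_of_nonpos (by nlinarith)] at b2
  have hw : ‖w‖ = ‖u - 1/2‖ * ‖u + 1/2‖ := by
    rw [← norm_mul, ← norm_neg]; congr 1; linear_combination -h
  have hu : 1/2 ≤ ‖u + 1/2‖ := by
    refine le_trans ?_ (Complex.re_le_norm _)
    simp; exact h0
  have hw2 : ‖u - 1/2‖ ≤ 2 * ‖w‖ := by
    rw [hw]; nlinarith [norm_nonneg (u - 1/2)]
  have hn : ‖(s:ℂ) * (u - 1/2) / 2‖ ≤ s * ‖w‖ := by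
    rw [norm_div, norm_mul, Complex.norm_real, Real.norm_of_nonneg hs]
    simp only [Complex.norm_ofNat]
    nlinarith
  rw [e, norm_mul, norm_mul]
  simp only [Complex.norm_ofNat]
  calc _ ≤ 2 * Real.exp (s * (u.re + 1/2) / 2) * ((s * ‖w‖) * Real.exp (-(s * (u.re - 1/2) / 2))) := by
        gcongr
        exact b2.trans (by gcongr)
    _ = 2 * (s * ‖w‖) * (Real.exp (s * (u.re + 1/2) / 2) * Real.exp (-(s * (u.re - 1/2) / 2))) := by ring
    _ = _ := by rw [← Real.exp_add]; ring_nf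

lemma hasDeriv_tS (u : ℂ) (s : ℝ) :
    HasDerivAt (fun s : ℝ => (s:ℂ) * lfS ((s:ℂ)^2 * u^2)) (Complex.cosh (s * u)) s := by
  by_cases hu : u = 0
  · subst hu
    simp only [ne_eq, OfNat.ofNat_ne_zero, not_false_eq_true, zero_pow, mul_zero, lfS_zero,
      Complex.cosh_zero, mul_one]
    exact (hasDerivAt_id (s:ℂ)).comp_ofReal
  · have : (fun s : ℝ => (s:ℂ) * lfS ((s:ℂ)^2 * u^2)) = fun s : ℝ => Complex.sinh (s * u) / u := by
      ext s
      rw [← mul_pow, ← lfS_sq]; field_simp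
    rw [this]
    have h : HasDerivAt (fun x : ℂ => Complex.sinh (x * u) / u) (Complex.cosh (s * u) * (1 * u) / u) (s:ℂ) :=
      (((hasDerivAt_id (s:ℂ)).mul_const u).csinh).div_const u
    have e : Complex.cosh (s * u) * (1 * u) / u = Complex.cosh (s * u) := by field_simp
    rw [e] at h
    exact h.comp_ofReal

lemma exists_sqrt (w : ℂ) (hw : w.im ^ 2 ≤ w.re) :
    ∃ u : ℂ, u ^ 2 = 1/4 - w ∧ 0 ≤ u.re ∧ u.re ≤ 1/2 := by
  obtain ⟨u0, hu0⟩ := IsSquare.pow (n := 1) (IsAlgClosed.exists_pow_nat_eq (1/4 - w) (n := 2) (by norm_num) |>.imp fun a h => (by rw [← h]; ring : (1/4 - w) = a * a))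
  have : ∃ u : ℂ, u ^ 2 = 1/4 - w ∧ 0 ≤ u.re := by
    rcases le_total 0 u0.re with h | h
    · exact ⟨u0, by rw [pow_one] at hu0; rw [hu0]; ring, h⟩
    · exact ⟨-u0, by rw [pow_one] at hu0; rw [hu0]; ring, by simpa using h⟩
  obtain ⟨u, hu, h0⟩ := this
  refine ⟨u, hu, h0, ?_⟩
  by_contra hc
  push Not at hc
  have hre := congrArg Complex.re hu
  have him := congrArg Complex.im hu
  rw [pow_two] at hre him
  simp [Complex.mul_re, Complex.mul_im] at hre him
  norm_num at hre
  have hi : u.im ^ 2 ≤ w.im ^ 2 := by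
    have : w.im ^ 2 = (2 * u.re) ^ 2 * u.im ^ 2 := by
      have : w.im = - (2 * u.re * u.im) := by linarith
      rw [this]; ring
    rw [this]
    nlinarith [sq_nonneg u.im, mul_nonneg (sq_nonneg u.im) (by nlinarith : 0 ≤ (2*u.re)^2 - 1)]
  nlinarith

lemma lfG_sub_bound (w : ℂ) (hw : w.im ^ 2 ≤ w.re) (t : ℝ) (ht : 0 ≤ t) :
    ‖lfG t w - lfG t 0‖ ≤ 4 * t * ‖w‖ := by
  obtain ⟨u, hu, h0, h1⟩ := exists_sqrt w hw
  set D : ℝ → ℂ := fun s => (s:ℂ) * lfS ((s:ℂ)^2 * u^2) - (s:ℂ) * lfS ((s:ℂ)^2 * (1/2)^2) with hD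
  have hd : ∀ s : ℝ, HasDerivAt D (Complex.cosh (s * u) - Complex.cosh (s * (1/2))) s :=
    fun s => (hasDeriv_tS u s).sub (hasDeriv_tS (1/2) s)
  have key : ‖D t‖ ≤ 4 * t * ‖w‖ * Real.exp (t / 2) := by
    refine image_norm_le_of_norm_deriv_right_le_deriv_boundary (a := 0) (b := t) (f := D)
      (B := fun s => 4 * s * ‖w‖ * Real.exp (s / 2))
      (B' := fun s => (4 * 1 * ‖w‖) * Real.exp (s / 2) + 4 * s * ‖w‖ * (Real.exp (s / 2) * (1 / 2)))
      (fun s _ => (hd s).continuousAt.continuousWithinAt)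
      (fun s _ => (hd s).hasDerivWithinAt) ?_ ?_ ?_ (Set.right_mem_Icc.2 ht)
    · simp [hD]
    · intro s
      exact (((hasDerivAt_id s).const_mul 4).mul_const ‖w‖).mul
        (((hasDerivAt_id s).div_const 2).exp)
    · intro s hs
      refine (cosh_sub_bound u w hu h0 h1 s hs.1).trans ?_
      have := Real.exp_pos (s/2)
      have h4 : 0 ≤ ‖w‖ * Real.exp (s/2) := by positivity
      nlinarith
  have e : lfG t w - lfG t 0 = ((Real.exp (-(t/2)) : ℝ) : ℂ) * D t := by
    simp only [lfG, hD]
    rw [hu]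
    push_cast
    have : (1/2:ℂ)^2 = 1/4 - 0 := by norm_num
    rw [this]; ring
  rw [e, norm_mul, Complex.norm_real, Real.norm_of_nonneg (Real.exp_pos _).le]
  calc _ ≤ Real.exp (-(t/2)) * (4 * t * ‖w‖ * Real.exp (t / 2)) := by gcongr
    _ = 4 * t * ‖w‖ * (Real.exp (-(t/2)) * Real.exp (t/2)) := by ring
    _ = _ := by rw [← Real.exp_add]; simp

lemma fd_bound (A : ℝ) (N : ℕ) : ∀ (f : ℕ → ℝ → ℂ) (a : ℝ),
    (∀ k < N, ∀ s ∈ Set.Icc a (a + N), HasDerivAt (f k) (f (k+1) s) s) →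
    (∀ s ∈ Set.Icc a (a + N), ‖f N s‖ ≤ A) → ‖(fwdDiff (1:ℝ))^[N] (f 0) a‖ ≤ A := by
  induction N with
  | zero =>
    intro f a _ h
    simpa using h a (by simp)
  | succ N ih =>
    intro f a hd hb
    rw [Function.iterate_succ_apply]
    push_cast at hd hb
    refine ih (fun k => fwdDiff 1 (f k)) a ?_ ?_
    · intro k hk s hs
      have h1 := hd k (by omega) s ⟨hs.1, by linarith [hs.2]⟩
      have h2 := hd k (by omega) (s+1) ⟨by linarith [hs.1], by linarith [hs.2]⟩
      have h3 : HasDerivAt (fun x => f k (x + 1)) (f (k+1) (s+1)) s := by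
        simpa using h2.comp_add_const s 1
      exact h3.sub h1
    · intro s hs
      have := Convex.norm_image_sub_le_of_norm_hasDerivWithin_le (f := f N) (f' := f (N+1)) (s := Set.Icc s (s+1))
        (x := s) (y := s + 1) (C := A) ?_ ?_ (convex_Icc _ _) (by simp) (by simp)
      · simpa [fwdDiff] using this
      · intro x hx
        exact (hd N (by omega) x ⟨by linarith [hs.1, hx.1], by linarith [hs.2, hx.2]⟩).hasDerivWithinAt
      · intro x hx
        exact hb x ⟨by linarith [hs.1, hx.1], by linarith [hs.2, hx.2]⟩

lemma fwdDiff_line {E : Type*} [AddCommGroup E] [Module ℝ E] (M : E → ℂ) (g : ℝ → ℂ) (v η : E) (N : ℕ)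
    (h : ∀ s ∈ Set.Icc (0:ℝ) N, g s = M (η + s • v)) :
    (fwdDiff v)^[N] M η = (fwdDiff (1:ℝ))^[N] g 0 := by
  rw [fwdDiff_iter_eq_sum_shift, fwdDiff_iter_eq_sum_shift]
  refine Finset.sum_congr rfl fun k hk => ?_
  rw [h _ ?_]
  · congr 2
    simp [Nat.cast_smul_eq_nsmul]
  · simp only [Finset.mem_range] at hk
    simp only [nsmul_eq_mul, mul_one, zero_add, Set.mem_Icc, Nat.cast_nonneg, true_and, Nat.cast_le]
    omega

lemma fwdDiff_norm_le {E : Type*} [AddCommGroup E] [Module ℝ E] (M : E → ℂ) (v η : E) (N : ℕ) (A : ℝ)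
    (h : ∀ k ≤ N, ‖M (η + (k:ℝ) • v)‖ ≤ A) : ‖(fwdDiff v)^[N] M η‖ ≤ 2 ^ N * A := by
  rw [fwdDiff_iter_eq_sum_shift]
  calc _ ≤ ∑ k ∈ Finset.range (N+1), (N.choose k : ℝ) * A := by
        refine norm_sum_le_of_le _ fun k hk => ?_
        rw [zsmul_eq_mul, norm_mul]
        push_cast
        rw [norm_mul, norm_pow, norm_neg, norm_one, one_pow, one_mul, Complex.norm_natCast]
        gcongr
        simpa [Nat.cast_smul_eq_nsmul] using h k (by simp at hk; omega)
    _ = _ := by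
        rw [← Finset.sum_mul]
        congr 1
        exact_mod_cast Nat.sum_range_choose N

lemma iter_ofReal (B : ℂ → ℂ) (U : Set ℂ) (hU : IsOpen U) (hB : DifferentiableOn ℂ B U) (k : ℕ) :
    ∀ s : ℝ, (s:ℂ) ∈ U → iteratedDeriv k (fun s : ℝ => B s) s = iteratedDeriv k B s := by
  induction k with
  | zero => intro s _; simp
  | succ k ih =>
    intro s hs
    rw [iteratedDeriv_succ, iteratedDeriv_succ]
    have hev : iteratedDeriv k (fun s : ℝ => B s) =ᶠ[nhds s] fun s : ℝ => iteratedDeriv k B s := by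
      have : ∀ᶠ x : ℝ in nhds s, (x:ℂ) ∈ U :=
        Complex.continuous_ofReal.continuousAt.eventually (hU.mem_nhds hs)
      filter_upwards [this] with x hx using ih x hx
    rw [hev.deriv_eq]
    have han : AnalyticAt ℂ B s := hB.analyticAt (hU.mem_nhds hs)
    have h2 : DifferentiableAt ℂ (iteratedDeriv k B) s := by
      rw [iteratedDeriv_eq_iterate]; exact (han.iterated_deriv k).differentiableAt
    exact h2.hasDerivAt.comp_ofReal.deriv

lemma contDiffAt_ofReal (B : ℂ → ℂ) (U : Set ℂ) (hU : IsOpen U) (hB : DifferentiableOn ℂ B U)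
    (s : ℝ) (hs : (s:ℂ) ∈ U) (k : ℕ) : ContDiffAt ℝ k (fun s : ℝ => B s) s := by
  have han : AnalyticAt ℂ B s := hB.analyticAt (hU.mem_nhds hs)
  have h1 : ContDiffAt ℝ k B (s:ℂ) := (han.contDiffAt (n := k)).restrict_scalars ℝ
  exact h1.comp s (Complex.ofRealCLM.contDiff.contDiffAt)

lemma hasDeriv_iter (g : ℝ → ℂ) (s : ℝ) (k : ℕ) (h : ContDiffAt ℝ (k+1 : ℕ) g s) :
    HasDerivAt (iteratedDeriv k g) (iteratedDeriv (k+1) g s) s := by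
  rw [iteratedDeriv_succ]
  refine DifferentiableAt.hasDerivAt ?_
  have := ContDiffWithinAt.differentiableWithinAt_iteratedDerivWithin (m := k) (s := Set.univ)
    (contDiffWithinAt_univ.2 h) (by exact_mod_cast Nat.lt_succ_self k) (by simpa using uniqueDiffOn_univ)
  rw [iteratedDerivWithin_univ] at this
  exact this.differentiableAt univ_mem

lemma line_iter {E : Type*} [NormedAddCommGroup E] [NormedSpace ℝ E] (χ : SchwartzMap E ℂ) (η v : E) (k : ℕ) :
    iteratedDeriv k (fun s : ℝ => χ (η + s • v)) =
      fun s => iteratedFDeriv ℝ k χ (η + s • v) (fun _ => v) := by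
  induction k with
  | zero => ext s; simp
  | succ k ih =>
    ext s
    rw [iteratedDeriv_succ, ih, iteratedFDeriv_succ_apply_left]
    have hd : DifferentiableAt ℝ (iteratedFDeriv ℝ k χ) (η + s • v) :=
      ((χ.smooth (k+1)).differentiable_iteratedFDeriv (m := k) (by exact_mod_cast Nat.lt_succ_self k)).differentiableAt
    have hl : HasDerivAt (fun s : ℝ => η + s • v) v s := by
      simpa using ((hasDerivAt_id s).smul_const v).const_add η
    have h1 := hd.hasFDerivAt.comp_hasDerivAt s hl
    have h2 := ((ContinuousMultilinearMap.apply ℝ (fun _ : Fin k => E) ℂ (fun _ => v)).hasFDerivAt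
      (x := iteratedFDeriv ℝ k χ (η + s • v))).comp_hasDerivAt s h1
    exact h2.deriv

lemma line_bound (N : ℕ) (Cc : ℝ) (hC : 0 ≤ Cc) : ∃ K : ℝ, 0 ≤ K ∧ ∀ (B : ℂ → ℂ) (c : ℝ → ℂ) (ρ A : ℝ), 0 < ρ → 2 * (N:ℝ) ≤ ρ →
    0 ≤ A → DifferentiableOn ℂ B (Metric.ball 0 ρ) → (∀ z ∈ Metric.ball (0:ℂ) ρ, ‖B z‖ ≤ A) →
    ContDiff ℝ N c → (∀ k ≤ N, ∀ s ∈ Set.Icc (0:ℝ) N, ‖iteratedDeriv k c s‖ ≤ Cc * (1/ρ) ^ k) →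
    ‖(fwdDiff (1:ℝ))^[N] (fun s : ℝ => B s * c s) 0‖ ≤ K * A * (1/ρ)^N := by
  refine ⟨∑ i ∈ Finset.range (N + 1), (N.choose i : ℝ) * i.factorial * 4 ^ i * Cc, by positivity, ?_⟩
  intro B c ρ A hρ hN hA hB hbd hc hcb
  have hmem : ∀ s ∈ Set.Icc (0:ℝ) N, (s:ℂ) ∈ Metric.ball (0:ℂ) ρ := by
    intro s hs
    simp only [Metric.mem_ball, dist_zero_right, Complex.norm_real, Real.norm_of_nonneg hs.1]
    have := hs.1; have := hs.2; linarith
  have hcd : ∀ s ∈ Set.Icc (0:ℝ) N, ∀ k ≤ N, ContDiffAt ℝ k (fun s : ℝ => B s * c s) s := by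
    intro s hs k hk
    exact (contDiffAt_ofReal B _ Metric.isOpen_ball hB s (hmem s hs) k).mul
      ((hc.of_le (by exact_mod_cast hk)).contDiffAt)
  have := fd_bound (A := (∑ i ∈ Finset.range (N + 1), (N.choose i : ℝ) * i.factorial * 4 ^ i * Cc) * A * (1/ρ)^N) N
    (fun k => iteratedDeriv k (fun s : ℝ => B s * c s)) 0 ?_ ?_
  · simpa using this
  · intro k hk s hs
    rw [zero_add] at hs
    exact hasDeriv_iter _ s k (hcd s hs _ hk)
  · intro s hs
    rw [zero_add] at hs
    rw [iteratedDeriv_fun_mul (contDiffAt_ofReal B _ Metric.isOpen_ball hB s (hmem s hs) N) hc.contDiffAt,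
      Finset.sum_mul, Finset.sum_mul]
    refine norm_sum_le_of_le _ fun i hi => ?_
    have hi' : i ≤ N := by simp at hi; omega
    rw [norm_mul, norm_mul, Complex.norm_natCast, iter_ofReal B _ Metric.isOpen_ball hB i s (hmem s hs)]
    have hsub : Metric.closedBall (s:ℂ) (ρ/4) ⊆ Metric.ball 0 ρ := by
      refine Metric.closedBall_subset_ball' ?_
      rw [dist_zero_right, Complex.norm_real, Real.norm_of_nonneg hs.1]
      have := hs.2; linarith
    have h1 := Complex.norm_iteratedDeriv_le_of_forall_mem_sphere_norm_le (f := B) (c := (s:ℂ)) (R := ρ/4) (C := A) i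
      (by positivity) ((hB.mono hsub).diffContOnCl_ball subset_rfl)
      (fun z hz => hbd z (hsub (Metric.sphere_subset_closedBall hz)))
    have h2 := hcb (N - i) (by omega) s hs
    calc _ ≤ (N.choose i : ℝ) * (i.factorial * A / (ρ/4)^i) * (Cc * (1/ρ)^(N-i)) := by gcongr
      _ = _ := by
        have e : (1/ρ)^N = (1/ρ)^i * (1/ρ)^(N-i) := by rw [← pow_add]; congr 1; omega
        have e2 : i.factorial * A / (ρ/4)^i = i.factorial * A * 4^i * (1/ρ)^i := by
          rw [div_pow, one_div, inv_pow]; field_simp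
        rw [e, e2]; ring

def lfM {E : Type*} [NormedAddCommGroup E] [NormedSpace ℝ E] (χ : SchwartzMap E ℂ) (σ t : ℝ) (ξ : E) : ℂ :=
  (lfG t ((‖ξ‖ ^ σ : ℝ) : ℂ) - lfG t 0) * χ ξ

lemma exists_c (σ ε : ℝ) (hε : 0 < ε) : ∃ c : ℝ, 0 < c ∧ c ≤ 1/4 ∧
    ∀ δ : ℂ, ‖δ‖ ≤ 3 * c → ‖(1 + δ) ^ ((σ/2 : ℝ) : ℂ) - 1‖ ≤ ε := by
  have hc : ContinuousAt (fun δ : ℂ => (1 + δ) ^ ((σ/2 : ℝ) : ℂ)) 0 := by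
    refine ContinuousAt.cpow (by fun_prop) continuousAt_const ?_
    simp
  rw [Metric.continuousAt_iff] at hc
  obtain ⟨d, hd, h⟩ := hc ε hε
  refine ⟨min (1/4) (d/4), by positivity, min_le_left _ _, fun δ hδ => ?_⟩
  have : ‖δ‖ < d := by
    have := min_le_right (1/4) (d/4)
    linarith
  have := h (x := δ) (by simpa using this)
  rw [dist_eq_norm] at this
  simpa using this.le

lemma lfM_fd {E : Type*} [NormedAddCommGroup E] [InnerProductSpace ℝ E] (χ : SchwartzMap E ℂ) (σ : ℝ) (hσ : 0 < σ)
    (hχ : ∀ ξ, χ ξ ≠ 0 → ‖ξ‖ ^ σ ≤ 1/4) (N : ℕ) :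
    ∃ c K : ℝ, 0 < c ∧ 0 ≤ K ∧ ∀ (t : ℝ) (η v : E), 0 ≤ t → v ≠ 0 → η ≠ 0 → 2 * N * ‖v‖ ≤ c * ‖η‖ →
      ‖(fwdDiff v)^[N] (lfM χ σ t) η‖ ≤ K * t * ‖η‖ ^ σ * (‖v‖ / ‖η‖) ^ N := by
  obtain ⟨c, hc0, hc4, hc⟩ := exists_c σ (min (1/4) ((2:ℝ) ^ (-σ))) (by positivity)
  choose Ck hCk0 hCk using fun k => χ.decay k k
  set Cc : ℝ := ∑ k ∈ Finset.range (N+1), Ck k * 2 ^ k with hCc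
  have hCc0 : 0 ≤ Cc := Finset.sum_nonneg fun k _ => by have := hCk0 k; positivity
  obtain ⟨K, hK0, hK⟩ := line_bound N Cc hCc0
  refine ⟨c, K * 5 * (1/c)^N, hc0, by positivity, ?_⟩
  intro t η v ht hv hη hvη
  have hv' : 0 < ‖v‖ := norm_pos_iff.2 hv
  have hη' : 0 < ‖η‖ := norm_pos_iff.2 hη
  set ρ := c * ‖η‖ / ‖v‖ with hρ
  have hρ0 : 0 < ρ := by positivity
  have hρN : 2 * (N:ℝ) ≤ ρ := by rw [hρ, le_div_iff₀ hv']; exact hvη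
  have hρv : ρ * ‖v‖ = c * ‖η‖ := by rw [hρ]; field_simp
  -- lower bound on the segment
  have hlow : ∀ s ∈ Set.Icc (0:ℝ) N, ‖η‖ / 2 ≤ ‖η + s • v‖ := by
    intro s hs
    have h1 : ‖s • v‖ ≤ ‖η‖ / 2 := by
      rw [norm_smul, Real.norm_of_nonneg hs.1]
      nlinarith [hs.2, mul_le_mul_of_nonneg_right hs.2 hv'.le]
    have h2 := norm_sub_norm_le η (-(s • v))
    rw [sub_neg_eq_add, norm_neg] at h2
    linarith
  by_cases hall : ∀ s ∈ Set.Icc (0:ℝ) N, χ (η + s • v) = 0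
  · rw [fwdDiff_line (lfM χ σ t) (fun _ => 0) v η N (fun s hs => by simp [lfM, hall s hs])]
    have : (fwdDiff (1:ℝ))^[N] (fun _ : ℝ => (0:ℂ)) 0 = 0 := by
      rw [fwdDiff_iter_eq_sum_shift]; simp
    rw [this, norm_zero]; positivity
  push Not at hall
  obtain ⟨s0, hs0, hχ0⟩ := hall
  have hr : ‖η‖ ^ σ ≤ 2 ^ σ / 4 := by
    have h1 := hχ _ hχ0
    have h2 : (‖η‖ / 2) ^ σ ≤ 1/4 := (Real.rpow_le_rpow (by positivity) (hlow s0 hs0) hσ.le).trans h1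
    rw [Real.div_rpow hη'.le (by norm_num)] at h2
    rw [div_le_iff₀ (by positivity)] at h2
    linarith
  set r := ‖η‖ ^ σ with hrdef
  have hr0 : 0 < r := by positivity
  set δ : ℂ → ℂ := fun z => (2 * z * (⟪η, v⟫ : ℝ) + z ^ 2 * (‖v‖ ^ 2 : ℝ)) / (‖η‖ ^ 2 : ℝ) with hδ
  have hδb : ∀ z ∈ Metric.ball (0:ℂ) ρ, ‖δ z‖ ≤ 3 * c := by
    intro z hz
    simp only [Metric.mem_ball, dist_zero_right] at hz
    have hzv : ‖z‖ * ‖v‖ ≤ c * ‖η‖ := by rw [← hρv]; gcongr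
    rw [hδ]
    simp only
    rw [norm_div, Complex.norm_real, Real.norm_of_nonneg (by positivity), div_le_iff₀ (by positivity)]
    refine (norm_add_le _ _).trans ?_
    rw [norm_mul, norm_mul, norm_mul, norm_pow, Complex.norm_real, Complex.norm_real, Real.norm_of_nonneg (by positivity : 0 ≤ ‖v‖^2)]
    simp only [Complex.norm_ofNat]
    have hin : ‖(⟪η, v⟫ : ℝ)‖ ≤ ‖η‖ * ‖v‖ := norm_inner_le_norm η v
    have h1 : 2 * ‖z‖ * ‖(⟪η, v⟫ : ℝ)‖ ≤ 2 * c * ‖η‖^2 := by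
      calc _ ≤ 2 * ‖z‖ * (‖η‖ * ‖v‖) := by gcongr
        _ = 2 * (‖z‖ * ‖v‖) * ‖η‖ := by ring
        _ ≤ 2 * (c * ‖η‖) * ‖η‖ := by gcongr
        _ = _ := by ring
    have h2 : ‖z‖^2 * ‖v‖^2 ≤ c * ‖η‖^2 := by
      calc _ = (‖z‖ * ‖v‖)^2 := by ring
        _ ≤ (c * ‖η‖)^2 := by gcongr
        _ = c * (c * ‖η‖^2) := by ring
        _ ≤ c * (1 * ‖η‖^2) := by gcongr; linarith
        _ = _ := by ring
    linarith
  set p : ℂ → ℂ := fun z => (1 + δ z) ^ ((σ/2 : ℝ) : ℂ) with hp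
  have hpd : DifferentiableOn ℂ p (Metric.ball 0 ρ) := by
    intro z hz
    refine DifferentiableAt.differentiableWithinAt ?_
    have : DifferentiableAt ℂ δ z := by rw [hδ]; fun_prop
    refine DifferentiableAt.cpow (this.const_add 1) (differentiableAt_const _) ?_
    refine Complex.mem_slitPlane_iff.2 (Or.inl ?_)
    have h1 := Complex.abs_re_le_norm (δ z)
    have h2 := hδb z hz
    have h3 := neg_abs_le (δ z).re
    simp only [Complex.add_re, Complex.one_re]
    linarith
  set B : ℂ → ℂ := fun z => lfG t ((r:ℂ) * p z) - lfG t 0 with hB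
  have hBd : DifferentiableOn ℂ B (Metric.ball 0 ρ) := by
    intro z hz
    exact (((lfG_diff t) _).comp_differentiableWithinAt z ((hpd z hz).const_mul (r:ℂ))).sub_const _
  have hBb : ∀ z ∈ Metric.ball (0:ℂ) ρ, ‖B z‖ ≤ 5 * t * r := by
    intro z hz
    have hpz : ‖p z - 1‖ ≤ min (1/4) ((2:ℝ) ^ (-σ)) := hc _ (hδb z hz)
    have hpz1 := hpz.trans (min_le_left _ _)
    have hpz2 := hpz.trans (min_le_right _ _)
    have him := Complex.abs_im_le_norm (p z - 1)
    have hre := Complex.abs_re_le_norm (p z - 1)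
    simp only [Complex.sub_im, Complex.one_im, sub_zero, Complex.sub_re, Complex.one_re] at him hre
    have hre2 : 3/4 ≤ (p z).re := by
      have := neg_abs_le ((p z).re - 1); linarith
    have hprod : r * (2:ℝ) ^ (-σ) ≤ 1/4 := by
      calc _ ≤ ((2:ℝ) ^ σ / 4) * (2:ℝ) ^ (-σ) := by gcongr
        _ = ((2:ℝ) ^ σ * (2:ℝ) ^ (-σ)) / 4 := by ring
        _ = 1/4 := by rw [← Real.rpow_add (by norm_num)]; simp
    have hwi : ((r:ℂ) * p z).im ^ 2 ≤ ((r:ℂ) * p z).re := by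
      rw [Complex.re_ofReal_mul, Complex.im_ofReal_mul]
      have hi2 : (p z).im ^ 2 ≤ 1/4 * 2 ^ (-σ) := by
        rw [← sq_abs, pow_two]
        exact mul_le_mul (him.trans hpz1) (him.trans hpz2) (abs_nonneg _) (by norm_num)
      calc (r * (p z).im)^2 = r * (r * (p z).im^2) := by ring
        _ ≤ r * (r * (1/4 * 2 ^ (-σ))) := by gcongr
        _ = r * (1/4 * (r * 2 ^ (-σ))) := by ring
        _ ≤ r * (1/4 * (1/4)) := by gcongr
        _ ≤ r * (p z).re := by gcongr; linarith
    refine (lfG_sub_bound _ hwi t ht).trans ?_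
    have hpn : ‖p z‖ ≤ 5/4 := by
      have := norm_add_le (p z - 1) 1
      simp only [sub_add_cancel, norm_one] at this
      linarith
    rw [norm_mul, Complex.norm_real, Real.norm_of_nonneg hr0.le]
    calc 4 * t * (r * ‖p z‖) ≤ 4 * t * (r * (5/4)) := by gcongr
      _ = _ := by ring
  have hcs : ContDiff ℝ N (fun s : ℝ => χ (η + s • v)) := by
    have := χ.smooth N
    fun_prop
  have hmain := hK B (fun s : ℝ => χ (η + s • v)) ρ (5 * t * r) hρ0 hρN (by positivity) hBd hBb hcs ?_
  · rw [fwdDiff_line (lfM χ σ t) (fun s : ℝ => B s * χ (η + s • v)) v η N ?_]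
    · refine hmain.trans (le_of_eq ?_)
      have : 1/ρ = 1/c * (‖v‖/‖η‖) := by rw [hρ]; field_simp
      rw [this, mul_pow]; ring
    · intro s hs
      simp only [lfM, hB]
      congr 3
      have hδs : δ s = (((2 * s * ⟪η, v⟫ + s^2 * ‖v‖^2) / ‖η‖^2 : ℝ) : ℂ) := by
        rw [hδ]; push_cast; rfl
      have hq : ‖η + s • v‖ ^ 2 = ‖η‖^2 * (1 + (2 * s * ⟪η, v⟫ + s^2 * ‖v‖^2) / ‖η‖^2) := by
        rw [norm_add_sq_real, norm_smul, inner_smul_right, mul_pow, Real.norm_eq_abs, sq_abs]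
        field_simp
        ring
      set d := (2 * s * ⟪η, v⟫ + s^2 * ‖v‖^2) / ‖η‖^2 with hd
      have hd0 : 0 ≤ 1 + d := by
        by_contra hneg
        push Not at hneg
        have : ‖η + s • v‖ ^ 2 < 0 := by rw [hq]; exact mul_neg_of_pos_of_neg (by positivity) hneg
        nlinarith [sq_nonneg ‖η + s • v‖]
      simp only [hp]
      rw [hδs]
      have : (1 + (d:ℂ)) ^ ((σ/2:ℝ):ℂ) = (((1 + d) ^ (σ/2) : ℝ) : ℂ) := by
        rw [Complex.ofReal_cpow hd0]; push_cast; rfl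
      rw [this, ← Complex.ofReal_mul]
      congr 1
      have e1 : ∀ y : ℝ, 0 ≤ y → y ^ σ = (y^2) ^ (σ/2) := by
        intro y hy
        rw [← Real.rpow_natCast, ← Real.rpow_mul hy]; congr 1; push_cast; ring
      rw [e1 _ (norm_nonneg (η + s • v)), hq, Real.mul_rpow (by positivity) hd0, ← e1 _ hη'.le]
  · intro k hk s hs
    rw [line_iter]
    simp only
    have hy := hlow s hs
    have hy0 : 0 < ‖η + s • v‖ := by linarith
    refine (ContinuousMultilinearMap.le_opNorm _ _).trans ?_
    simp only [Finset.prod_const, Finset.card_univ, Fintype.card_fin]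
    have h1 := hCk k (η + s • v)
    have h2 : ‖iteratedFDeriv ℝ k χ (η + s • v)‖ * (‖η‖/2)^k ≤ Ck k := by
      refine le_trans ?_ h1
      rw [mul_comm]; gcongr
    have h3 : Ck k * 2 ^ k ≤ Cc :=
      Finset.single_le_sum (f := fun k => Ck k * 2 ^ k) (fun k _ => by have := hCk0 k; positivity)
        (by simp; omega)
    have h4 : ‖v‖ = ‖η‖ / 2 * 2 * c * (1/ρ) := by rw [hρ]; field_simp
    calc ‖iteratedFDeriv ℝ k χ (η + s • v)‖ * ‖v‖ ^ k
        = (‖iteratedFDeriv ℝ k χ (η + s • v)‖ * (‖η‖/2)^k) * 2^k * c^k * (1/ρ)^k := by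
          conv_lhs => rw [h4]
          simp only [mul_pow]; ring
      _ ≤ Ck k * 2^k * 1 * (1/ρ)^k := by
          have := hCk0 k
          gcongr
          exact pow_le_one₀ hc0.le (by linarith)
      _ ≤ Cc * (1/ρ)^k := by rw [mul_one]; gcongr

def lfI {n : ℕ} (f : Rn n → ℂ) (x : Rn n) : ℂ :=
  ∫ ξ, f ξ * Complex.exp (Complex.I * (⟪ξ, x⟫ : ℝ))

lemma norm_osc {n : ℕ} (ξ x : Rn n) : ‖Complex.exp (Complex.I * (⟪ξ, x⟫ : ℝ))‖ = 1 := by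
  rw [mul_comm]; exact Complex.norm_exp_ofReal_mul_I _

lemma osc_integrable {n : ℕ} (f : Rn n → ℂ) (hf : Integrable f) (x : Rn n) :
    Integrable (fun ξ => f ξ * Complex.exp (Complex.I * (⟪ξ, x⟫ : ℝ))) := by
  refine hf.mul_bdd (c := 1) ?_ (Eventually.of_forall fun ξ => (norm_osc ξ x).le)
  exact Continuous.aestronglyMeasurable (by fun_prop)

lemma fwdDiff_integrable {n : ℕ} (f : Rn n → ℂ) (hf : Integrable f) (v : Rn n) :
    Integrable (fwdDiff v f) := (hf.comp_add_right v).sub hf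

lemma lfI_fwdDiff {n : ℕ} (f : Rn n → ℂ) (hf : Integrable f) (x v : Rn n) (hv : (⟪v, x⟫ : ℝ) = π) :
    lfI (fwdDiff v f) x = -2 * lfI f x := by
  have h1 : ∫ ξ, f (ξ + v) * Complex.exp (Complex.I * (⟪ξ, x⟫ : ℝ)) = - lfI f x := by
    have e : ∀ ξ : Rn n, f (ξ + v) * Complex.exp (Complex.I * (⟪ξ, x⟫ : ℝ)) =
        (fun ζ => -(f ζ * Complex.exp (Complex.I * (⟪ζ, x⟫ : ℝ)))) (ξ + v) := by
      intro ξ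
      simp only [inner_add_left, hv]
      push_cast
      rw [mul_add, Complex.exp_add, mul_comm Complex.I (π : ℂ), Complex.exp_pi_mul_I]; ring
    simp_rw [e]
    rw [integral_add_right_eq_self (fun ζ => -(f ζ * Complex.exp (Complex.I * (⟪ζ, x⟫ : ℝ)))), integral_neg, lfI]
  have h2 : lfI (fwdDiff v f) x = (∫ ξ, f (ξ + v) * Complex.exp (Complex.I * (⟪ξ, x⟫ : ℝ))) - lfI f x := by
    rw [lfI, lfI, ← integral_sub (osc_integrable _ (hf.comp_add_right v) x) (osc_integrable _ hf x)]
    congr 1; ext ξ; simp only [fwdDiff]; ring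
  rw [h2, h1]; ring

lemma lfI_fwdDiff_iter {n : ℕ} (x v : Rn n) (hv : (⟪v, x⟫ : ℝ) = π) (N : ℕ) :
    ∀ (f : Rn n → ℂ), Integrable f → lfI ((fwdDiff v)^[N] f) x = (-2) ^ N * lfI f x := by
  induction N with
  | zero => intro f hf; simp
  | succ N ih =>
    intro f hf
    rw [Function.iterate_succ_apply, ih _ (fwdDiff_integrable f hf v), lfI_fwdDiff f hf x v hv]; ring

lemma lfI_norm_le {n : ℕ} (f : Rn n → ℂ) (x : Rn n) (g : Rn n → ℝ) (hg : Integrable g)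
    (h : ∀ ξ, ‖f ξ‖ ≤ g ξ) : ‖lfI f x‖ ≤ ∫ ξ, g ξ := by
  refine norm_integral_le_of_norm_le hg (Eventually.of_forall fun ξ => ?_)
  rw [norm_mul, norm_osc, mul_one]; exact h ξ

lemma lfM_norm_le {n : ℕ} (χ : SchwartzMap (Rn n) ℂ) (σ : ℝ) (t : ℝ) (ht : 0 ≤ t) (C0 : ℝ)
    (hC : ∀ ξ, ‖χ ξ‖ ≤ C0) (ξ : Rn n) : ‖lfM χ σ t ξ‖ ≤ 4 * t * ‖ξ‖ ^ σ * C0 := by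
  rw [lfM, norm_mul]
  have h0 : 0 ≤ ‖ξ‖ ^ σ := by positivity
  have := lfG_sub_bound ((‖ξ‖ ^ σ : ℝ) : ℂ) (by simpa using h0) t ht
  rw [Complex.norm_real, Real.norm_of_nonneg h0] at this
  gcongr
  exact hC ξ

lemma lfM_integrable {n : ℕ} (χ : SchwartzMap (Rn n) ℂ) (σ : ℝ) (hσ : 0 < σ) (hcs : HasCompactSupport χ) (t : ℝ) :
    Integrable (lfM χ σ t) := by
  refine Continuous.integrable_of_hasCompactSupport ?_ hcs.mul_left
  have h1 : Continuous (fun ξ : Rn n => lfG t ((‖ξ‖ ^ σ : ℝ) : ℂ)) :=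
    (lfG_diff t).continuous.comp (Complex.continuous_ofReal.comp
      (continuous_norm.rpow_const (fun _ => Or.inr hσ.le)))
  exact (h1.sub continuous_const).mul χ.continuous

lemma lfM_decay {n : ℕ} (χ : SchwartzMap (Rn n) ℂ) (σ : ℝ) (hσ : 0 < σ) (hcs : HasCompactSupport χ)
    (hχ : ∀ ξ, χ ξ ≠ 0 → ‖ξ‖ ^ σ ≤ 1/4) :
    ∃ K : ℝ, 0 ≤ K ∧ ∀ (t : ℝ) (x : Rn n), 0 ≤ t → x ≠ 0 →
      ‖lfI (lfM χ σ t) x‖ ≤ K * t * ‖x‖ ^ (-((n:ℝ) + σ)) := by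
  obtain ⟨N, hN⟩ := exists_nat_gt ((n:ℝ) + σ)
  obtain ⟨c, K, hc, hK, hfd⟩ := lfM_fd χ σ hσ hχ N
  obtain ⟨C0, hC0, hC0'⟩ := χ.decay 0 0
  simp only [pow_zero, one_mul, norm_iteratedFDeriv_zero] at hC0'
  set q : ℝ := N - σ with hq
  have hqn : (n:ℝ) < q := by rw [hq]; linarith
  have hq0 : 0 < q := lt_of_le_of_lt (Nat.cast_nonneg n) hqn
  set κ : ℝ := max (2 * N / c) 1 with hκ
  have hκ1 : 1 ≤ κ := le_max_right _ _
  set K1 : ℝ := K * 2 ^ q with hK1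
  set K2 : ℝ := 2 ^ N * (4 * (κ + N) ^ σ * C0) * (1 + κ) ^ q with hK2
  have hK10 : 0 ≤ K1 := by positivity
  have hK20 : 0 ≤ K2 := by positivity
  have hpt : ∀ (t : ℝ) (η v : Rn n), 0 ≤ t → v ≠ 0 →
      ‖(fwdDiff v)^[N] (lfM χ σ t) η‖ ≤ (K1 + K2) * t * ‖v‖ ^ σ * (1 + ‖‖v‖⁻¹ • η‖) ^ (-q) := by
    intro t η v ht hv
    have hv' : 0 < ‖v‖ := norm_pos_iff.2 hv
    rw [norm_smul, norm_inv, norm_norm]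
    set a := ‖v‖⁻¹ * ‖η‖ with ha
    have ha0 : 0 ≤ a := by positivity
    have hηa : ‖η‖ = ‖v‖ * a := by rw [ha]; field_simp
    have hP : 0 ≤ t * ‖v‖ ^ σ * (1 + a) ^ (-q) := by positivity
    rcases le_or_gt κ a with h | h
    · have ha1 : 1 ≤ a := hκ1.trans h
      have hη : η ≠ 0 := by
        rw [← norm_pos_iff, hηa]; positivity
      have h2 := hfd t η v ht hv hη (by
        have := (le_max_left (2 * N / c) 1).trans h
        rw [div_le_iff₀ hc] at this
        rw [hηa]; nlinarith)
      have e1 : ‖η‖ ^ σ * (‖v‖ / ‖η‖) ^ N = ‖v‖ ^ σ * a ^ (-q) := by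
        rw [hηa, Real.mul_rpow hv'.le ha0, hq, neg_sub, Real.rpow_sub (by linarith), Real.rpow_natCast]
        have : ‖v‖ / (‖v‖ * a) = 1 / a := by field_simp
        rw [this, one_div, inv_pow]; field_simp
      have e2 : a ^ (-q) ≤ 2 ^ q * (1 + a) ^ (-q) := by
        have h3 : ((1 + a)/2) ^ (-q) = 2 ^ q * (1 + a) ^ (-q) := by
          rw [Real.div_rpow (by positivity) (by norm_num), Real.rpow_neg (by norm_num : (0:ℝ) ≤ 2)]
          field_simp
        rw [← h3]
        exact Real.rpow_le_rpow_of_nonpos (by linarith) (by linarith) (by linarith)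
      calc _ ≤ K * t * ‖η‖ ^ σ * (‖v‖ / ‖η‖) ^ N := h2
        _ = K * t * (‖η‖ ^ σ * (‖v‖ / ‖η‖) ^ N) := by ring
        _ = K * t * (‖v‖ ^ σ * a ^ (-q)) := by rw [e1]
        _ ≤ K * t * (‖v‖ ^ σ * (2 ^ q * (1 + a) ^ (-q))) := by gcongr
        _ = K1 * (t * ‖v‖ ^ σ * (1 + a) ^ (-q)) := by rw [hK1]; ring
        _ ≤ (K1 + K2) * (t * ‖v‖ ^ σ * (1 + a) ^ (-q)) := by gcongr; linarith
        _ = _ := by ring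
    · have h2 := fwdDiff_norm_le (lfM χ σ t) v η N (4 * t * ((κ + N) * ‖v‖) ^ σ * C0) (by
        intro k hk
        refine (lfM_norm_le χ σ t ht C0 hC0' _).trans ?_
        gcongr
        refine (norm_add_le _ _).trans ?_
        rw [norm_smul, hηa, Real.norm_natCast, add_mul]
        have : (k:ℝ) ≤ N := by exact_mod_cast hk
        have : (k:ℝ) * ‖v‖ ≤ N * ‖v‖ := by gcongr
        nlinarith)
      have e2 : 1 ≤ (1 + κ) ^ q * (1 + a) ^ (-q) := by
        rw [Real.rpow_neg (by positivity), ← div_eq_mul_inv, one_le_div (by positivity)]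
        gcongr
      calc _ ≤ 2 ^ N * (4 * t * ((κ + N) * ‖v‖) ^ σ * C0) := h2
        _ = 2 ^ N * (4 * (κ + N) ^ σ * C0) * (t * ‖v‖ ^ σ) * 1 := by
            rw [Real.mul_rpow (by positivity) hv'.le]; ring
        _ ≤ 2 ^ N * (4 * (κ + N) ^ σ * C0) * (t * ‖v‖ ^ σ) * ((1 + κ) ^ q * (1 + a) ^ (-q)) := by gcongr
        _ = K2 * (t * ‖v‖ ^ σ * (1 + a) ^ (-q)) := by rw [hK2]; ring
        _ ≤ (K1 + K2) * (t * ‖v‖ ^ σ * (1 + a) ^ (-q)) := by gcongr; linarith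
        _ = _ := by ring
  have hint : Integrable (fun η : Rn n => (1 + ‖η‖) ^ (-q)) :=
    integrable_one_add_norm (by simpa using hqn)
  set J : ℝ := ∫ η : Rn n, (1 + ‖η‖) ^ (-q) with hJ
  have hJ0 : 0 ≤ J := integral_nonneg fun η => by positivity
  refine ⟨(K1 + K2) * J * π ^ ((n:ℝ) + σ), by positivity, ?_⟩
  intro t x ht hx
  have hx' : 0 < ‖x‖ := norm_pos_iff.2 hx
  set v : Rn n := (π / ‖x‖^2) • x with hv
  have hvn : ‖v‖ = π / ‖x‖ := by
    rw [hv, norm_smul, Real.norm_of_nonneg (by positivity)]; field_simp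
  have hv0' : 0 < ‖v‖ := by rw [hvn]; positivity
  have hv0 : v ≠ 0 := norm_pos_iff.1 hv0'
  have hvx : (⟪v, x⟫ : ℝ) = π := by
    rw [hv, real_inner_smul_left, real_inner_self_eq_norm_sq]; field_simp
  have hiter := lfI_fwdDiff_iter x v hvx N (lfM χ σ t) (lfM_integrable χ σ hσ hcs t)
  have hi2 : Integrable (fun η : Rn n => (K1 + K2) * t * ‖v‖ ^ σ * (1 + ‖‖v‖⁻¹ • η‖) ^ (-q)) :=
    (hint.comp_smul (by positivity : ‖v‖⁻¹ ≠ 0)).const_mul _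
  have hb := lfI_norm_le ((fwdDiff v)^[N] (lfM χ σ t)) x _ hi2 (fun η => hpt t η v ht hv0)
  rw [integral_const_mul, Measure.integral_comp_smul volume (fun η : Rn n => (1 + ‖η‖) ^ (-q)), ← hJ, hiter, norm_mul, norm_pow] at hb
  simp only [norm_neg, Complex.norm_ofNat, finrank_euclideanSpace, Fintype.card_fin, inv_pow, inv_inv, smul_eq_mul] at hb
  rw [abs_of_nonneg (by positivity)] at hb
  have h2N : (1:ℝ) ≤ 2 ^ N := one_le_pow₀ (by norm_num)
  calc ‖lfI (lfM χ σ t) x‖ ≤ 2 ^ N * ‖lfI (lfM χ σ t) x‖ := le_mul_of_one_le_left (norm_nonneg _) h2N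
    _ ≤ _ := hb
    _ = (K1 + K2) * J * t * (‖v‖ ^ (n:ℝ) * ‖v‖ ^ σ) := by rw [Real.rpow_natCast]; ring
    _ = (K1 + K2) * J * t * (π ^ ((n:ℝ) + σ) * ‖x‖ ^ (-((n:ℝ) + σ))) := by
        rw [← Real.rpow_add hv0', hvn, Real.div_rpow (by positivity) hx'.le, Real.rpow_neg hx'.le]; rfl
    _ = _ := by ring

lemma lfG_real (t r : ℝ) (hr : r < 1/4) :
    lfG t (r:ℂ) = ((Real.exp (-(t/2)) * (Real.sinh (t * Real.sqrt (1/4 - r)) / Real.sqrt (1/4 - r)) : ℝ) : ℂ) := by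
  have hu : 0 < Real.sqrt (1/4 - r) := Real.sqrt_pos.2 (by linarith)
  have hu2 : Real.sqrt (1/4 - r) ^ 2 = 1/4 - r := Real.sq_sqrt (by linarith)
  set u := Real.sqrt (1/4 - r)
  have h := lfS_sq ((t:ℂ) * u)
  have e : (t:ℂ)^2 * (1/4 - (r:ℂ)) = ((t:ℂ) * u)^2 := by
    rw [mul_pow]; congr 1
    have := congrArg (fun z : ℝ => (z:ℂ)) hu2
    push_cast at this; rw [this]
  have huc : (u:ℂ) ≠ 0 := by exact_mod_cast hu.ne'
  rw [lfG, e]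
  push_cast
  rw [← h]; field_simp

lemma sinh_le_mul_exp (y : ℝ) : Real.sinh y ≤ y * Real.exp y := by
  have h1 := Real.add_one_le_exp (-2 * y)
  have h2 : Real.exp (-y) = Real.exp y * Real.exp (-2 * y) := by rw [← Real.exp_add]; congr 1; ring
  rw [Real.sinh_eq, h2]
  have := Real.exp_pos y
  nlinarith

lemma sq_aux (r : ℝ) (hr0 : 0 ≤ r) (hr : r < 1/4) : Real.sqrt (1/4 - r) ≤ 1/2 - r := by
  rw [Real.sqrt_le_left (by linarith)]
  nlinarith

lemma real_bound1 (t r : ℝ) (ht : 0 ≤ t) (hr0 : 0 ≤ r) (hr : r < 1/4) :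
    Real.exp (-(t/2)) * (Real.sinh (t * Real.sqrt (1/4 - r)) / Real.sqrt (1/4 - r)) ≤ t := by
  have hu : 0 < Real.sqrt (1/4 - r) := Real.sqrt_pos.2 (by linarith)
  have hu2 := sq_aux r hr0 hr
  set u := Real.sqrt (1/4 - r)
  have h1 : Real.sinh (t * u) / u ≤ t * Real.exp (t * u) := by
    rw [div_le_iff₀ hu]; have := sinh_le_mul_exp (t * u); linarith
  calc _ ≤ Real.exp (-(t/2)) * (t * Real.exp (t * u)) := by gcongr
    _ = t * Real.exp (-(t/2) + t * u) := by rw [Real.exp_add]; ring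
    _ ≤ t * Real.exp 0 := by gcongr; nlinarith
    _ = t := by simp

lemma real_bound2 (t r : ℝ) (ht : 0 ≤ t) (hr0 : 0 ≤ r) (hr : r < 1/4) :
    Real.exp (-(t/2)) * (Real.sinh (t * Real.sqrt (1/4 - r)) / Real.sqrt (1/4 - r)) ≤ 8 * Real.exp (-(t * r / 2)) := by
  have hu : 0 < Real.sqrt (1/4 - r) := Real.sqrt_pos.2 (by linarith)
  have hu2 := sq_aux r hr0 hr
  set u := Real.sqrt (1/4 - r)
  rcases le_or_gt (1/4) u with h | h
  · have h1 : Real.sinh (t * u) / u ≤ 8 * Real.exp (t * u) := by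
      rw [div_le_iff₀ hu, Real.sinh_eq]
      have := Real.exp_pos (t * u)
      have := Real.exp_pos (-(t * u))
      nlinarith
    calc _ ≤ Real.exp (-(t/2)) * (8 * Real.exp (t * u)) := by gcongr
      _ = 8 * Real.exp (-(t/2) + t * u) := by rw [Real.exp_add]; ring
      _ ≤ _ := by gcongr; nlinarith [mul_nonneg ht hr0]
  · have h1 : Real.sinh (t * u) / u ≤ t * Real.exp (t * u) := by
      rw [div_le_iff₀ hu]; have := sinh_le_mul_exp (t * u); linarith
    have h2 : t ≤ 8 * Real.exp (t / 8) := by have := Real.add_one_le_exp (t/8); linarith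
    calc _ ≤ Real.exp (-(t/2)) * (t * Real.exp (t * u)) := by gcongr
      _ ≤ Real.exp (-(t/2)) * ((8 * Real.exp (t/8)) * Real.exp (t * u)) := by gcongr
      _ = 8 * Real.exp (-(t/2) + t/8 + t * u) := by rw [Real.exp_add, Real.exp_add]; ring
      _ ≤ _ := by gcongr; nlinarith

lemma real_nonneg (t r : ℝ) (ht : 0 ≤ t) :
    0 ≤ Real.exp (-(t/2)) * (Real.sinh (t * Real.sqrt (1/4 - r)) / Real.sqrt (1/4 - r)) := by
  have : 0 ≤ Real.sinh (t * Real.sqrt (1/4 - r)) := Real.sinh_nonneg_iff.2 (by positivity)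
  positivity

lemma lfG_b1 (t r : ℝ) (ht : 0 ≤ t) (hr0 : 0 ≤ r) (hr : r < 1/4) : ‖lfG t (r:ℂ)‖ ≤ t := by
  rw [lfG_real t r hr, Complex.norm_real, Real.norm_of_nonneg (real_nonneg t r ht)]
  exact real_bound1 t r ht hr0 hr

lemma lfG_b2 (t r : ℝ) (ht : 0 ≤ t) (hr0 : 0 ≤ r) (hr : r < 1/4) :
    ‖lfG t (r:ℂ)‖ ≤ 8 * Real.exp (-(t * r / 2)) := by
  rw [lfG_real t r hr, Complex.norm_real, Real.norm_of_nonneg (real_nonneg t r ht)]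
  exact real_bound2 t r ht hr0 hr

lemma exp_integrable (n : ℕ) (σ : ℝ) (hσ : 0 < σ) :
    Integrable (fun ξ : Rn n => Real.exp (-(‖ξ‖ ^ σ / 2))) := by
  have hint : Integrable (fun η : Rn n => (1 + ‖η‖) ^ (-((n:ℝ)+1))) :=
    integrable_one_add_norm (by simp)
  obtain ⟨k, hk⟩ := exists_nat_gt (((n:ℝ)+1)/σ)
  set D : ℝ := 2 ^ ((n:ℝ)+1) * (1 + k.factorial * 2 ^ k) with hD
  refine (hint.const_mul D).mono' ?_ (Eventually.of_forall fun ξ => ?_)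
  · refine Continuous.aestronglyMeasurable ?_
    have : Continuous (fun ξ : Rn n => ‖ξ‖ ^ σ) := continuous_norm.rpow_const (fun _ => Or.inr hσ.le)
    fun_prop
  rw [Real.norm_of_nonneg (Real.exp_pos _).le]
  set a := ‖ξ‖ with ha
  have ha0 : 0 ≤ a := norm_nonneg ξ
  rw [Real.rpow_neg (by positivity), ← div_eq_mul_inv, le_div_iff₀ (by positivity)]
  rcases le_or_gt a 1 with h | h
  · calc _ ≤ 1 * (1 + 1 : ℝ) ^ ((n:ℝ)+1) := by
          gcongr
          rw [Real.exp_le_one_iff]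
          have : 0 ≤ a ^ σ := by positivity
          linarith
      _ ≤ D := by
          rw [hD, one_add_one_eq_two, one_mul]
          refine le_mul_of_one_le_right (by positivity) ?_
          have : (0:ℝ) ≤ k.factorial * 2 ^ k := by positivity
          linarith
  · have h1 : (a ^ σ / 2) ^ k / k.factorial ≤ Real.exp (a ^ σ / 2) :=
      Real.pow_div_factorial_le_exp _ (by positivity) k
    have h2 : a ^ ((n:ℝ)+1) ≤ (a ^ σ) ^ k := by
      rw [← Real.rpow_natCast, ← Real.rpow_mul ha0]
      refine Real.rpow_le_rpow_of_exponent_le h.le ?_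
      rw [div_lt_iff₀ hσ] at hk; linarith
    have h3 : (1 + a) ^ ((n:ℝ)+1) ≤ 2 ^ ((n:ℝ)+1) * (a ^ σ) ^ k := by
      calc _ ≤ (2 * a) ^ ((n:ℝ)+1) := by gcongr; linarith
        _ = 2 ^ ((n:ℝ)+1) * a ^ ((n:ℝ)+1) := Real.mul_rpow (by norm_num) ha0
        _ ≤ _ := by gcongr
    have h4 : (a ^ σ) ^ k ≤ Real.exp (a ^ σ / 2) * (k.factorial * 2 ^ k) := by
      rw [div_le_iff₀ (by positivity), div_pow, div_le_iff₀ (by positivity)] at h1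
      linarith
    calc _ ≤ Real.exp (-(a ^ σ / 2)) * (2 ^ ((n:ℝ)+1) * (Real.exp (a ^ σ / 2) * (k.factorial * 2 ^ k))) := by
          gcongr; exact h3.trans (by gcongr)
      _ = 2 ^ ((n:ℝ)+1) * (k.factorial * 2 ^ k) * (Real.exp (-(a ^ σ / 2)) * Real.exp (a ^ σ / 2)) := by ring
      _ = 2 ^ ((n:ℝ)+1) * (k.factorial * 2 ^ k) := by rw [← Real.exp_add]; simp
      _ ≤ D := by rw [hD]; gcongr; linarith

lemma exp_integral (n : ℕ) (σ : ℝ) (hσ : 0 < σ) (t : ℝ) (ht : 0 < t) :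
    Integrable (fun ξ : Rn n => Real.exp (-(t * ‖ξ‖ ^ σ / 2))) ∧
    ∫ ξ : Rn n, Real.exp (-(t * ‖ξ‖ ^ σ / 2)) = t ^ (-(n:ℝ)/σ) * ∫ ξ : Rn n, Real.exp (-(‖ξ‖ ^ σ / 2)) := by
  have e : (fun ξ : Rn n => Real.exp (-(t * ‖ξ‖ ^ σ / 2))) =
      fun ξ => (fun ζ : Rn n => Real.exp (-(‖ζ‖ ^ σ / 2))) (t ^ (1/σ) • ξ) := by
    ext ξ
    simp only
    rw [norm_smul, Real.norm_of_nonneg (by positivity), Real.mul_rpow (by positivity) (norm_nonneg _),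
      ← Real.rpow_mul ht.le, one_div, inv_mul_cancel₀ hσ.ne', Real.rpow_one]
  rw [e]
  refine ⟨(exp_integrable n σ hσ).comp_smul (by positivity), ?_⟩
  rw [Measure.integral_comp_smul volume (fun ζ : Rn n => Real.exp (-(‖ζ‖ ^ σ / 2)))]
  rw [smul_eq_mul]
  congr 1
  rw [abs_of_nonneg (by positivity), finrank_euclideanSpace, Fintype.card_fin, ← Real.rpow_natCast,
    ← Real.rpow_mul ht.le, ← Real.rpow_neg ht.le]
  congr 1; ring

lemma jap_low {n : ℕ} (y : Rn n) (p : ℝ) (hp : 0 ≤ p) :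
    (‖y‖ ≤ 1 → 1 ≤ 2 ^ p * jap y ^ (-p)) ∧ (1 ≤ ‖y‖ → ‖y‖ ^ (-p) ≤ 2 ^ p * jap y ^ (-p)) := by
  have hj : 0 < jap y := Real.sqrt_pos.2 (by positivity)
  have hn := norm_nonneg y
  have e : 2 ^ p * jap y ^ (-p) = (jap y / 2) ^ (-p) := by
    rw [Real.div_rpow hj.le (by norm_num), Real.rpow_neg (by norm_num : (0:ℝ) ≤ 2)]; field_simp
  rw [e]
  constructor
  · intro h
    have : jap y ≤ 2 := by
      rw [jap, Real.sqrt_le_left (by norm_num)]; nlinarith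
    exact Real.one_le_rpow_of_pos_of_le_one_of_nonpos (by positivity) (by linarith) (by linarith)
  · intro h
    have : jap y ≤ 2 * ‖y‖ := by
      rw [jap, Real.sqrt_le_left (by positivity)]; nlinarith
    exact Real.rpow_le_rpow_of_nonpos (by positivity) (by linarith) (by linarith)

lemma combine {n : ℕ} (σ : ℝ) (hσ : 0 < σ) (F : ℝ → Rn n → ℂ) (K : ℝ) (hK : 0 < K)
    (H1 : ∀ t x, 0 < t → 1 ≤ ‖x‖ → ‖F t x‖ ≤ K * t * ‖x‖ ^ (-((n:ℝ) + σ)))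
    (H2 : ∀ t x, 0 < t → ‖F t x‖ ≤ K * t)
    (H3 : ∀ t x, 0 < t → ‖F t x‖ ≤ K * t ^ (-(n:ℝ)/σ)) :
    ∃ C : ℝ, 0 < C ∧ ∀ (t : ℝ), 0 < t → ∀ x : Rn n,
      (t ≤ 1 → ‖F t x‖ ≤ C * t * jap x ^ (-((n:ℝ) + σ))) ∧
      (1 ≤ t → ‖F t x‖ ≤ C * t ^ (-(n:ℝ)/σ) * jap (t ^ (-(1:ℝ)/σ) • x) ^ (-((n:ℝ) + σ))) := by
  set p := (n:ℝ) + σ with hp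
  have hp0 : 0 ≤ p := by positivity
  refine ⟨K * 2 ^ p, by positivity, fun t ht x => ⟨fun h1 => ?_, fun h1 => ?_⟩⟩
  · obtain ⟨j1, j2⟩ := jap_low x p hp0
    rcases le_total ‖x‖ 1 with h | h
    · calc _ ≤ K * t * 1 := by rw [mul_one]; exact H2 t x ht
        _ ≤ K * t * (2 ^ p * jap x ^ (-p)) := by gcongr; exact j1 h
        _ = _ := by ring
    · calc _ ≤ K * t * ‖x‖ ^ (-p) := H1 t x ht h
        _ ≤ K * t * (2 ^ p * jap x ^ (-p)) := by gcongr; exact j2 h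
        _ = _ := by ring
  · set y := t ^ (-(1:ℝ)/σ) • x with hy
    obtain ⟨j1, j2⟩ := jap_low y p hp0
    rcases le_total ‖y‖ 1 with h | h
    · calc _ ≤ K * t ^ (-(n:ℝ)/σ) * 1 := by rw [mul_one]; exact H3 t x ht
        _ ≤ K * t ^ (-(n:ℝ)/σ) * (2 ^ p * jap y ^ (-p)) := by gcongr; exact j1 h
        _ = _ := by ring
    · have hyx : ‖x‖ = t ^ (1/σ) * ‖y‖ := by
        rw [hy, norm_smul, Real.norm_of_nonneg (by positivity), ← mul_assoc, ← Real.rpow_add ht]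
        rw [show 1/σ + -1/σ = 0 by ring]; simp
      have ht1 : 1 ≤ t ^ (1/σ) := Real.one_le_rpow h1 (by positivity)
      have hx1 : 1 ≤ ‖x‖ := by rw [hyx]; nlinarith
      have e : t * ‖x‖ ^ (-p) = t ^ (-(n:ℝ)/σ) * ‖y‖ ^ (-p) := by
        rw [hyx, Real.mul_rpow (by positivity) (norm_nonneg _), ← Real.rpow_mul ht.le, ← mul_assoc]
        congr 1
        nth_rewrite 1 [← Real.rpow_one t]
        rw [← Real.rpow_add ht]; congr 1; rw [hp]; field_simp; ring
      calc _ ≤ K * t * ‖x‖ ^ (-p) := H1 t x ht hx1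
        _ = K * (t * ‖x‖ ^ (-p)) := by ring
        _ = K * t ^ (-(n:ℝ)/σ) * ‖y‖ ^ (-p) := by rw [e]; ring
        _ ≤ K * t ^ (-(n:ℝ)/σ) * (2 ^ p * jap y ^ (-p)) := by gcongr; exact j2 h
        _ = _ := by ring

lemma schwartz_lfI_decay {n : ℕ} (χ : SchwartzMap (Rn n) ℂ) (k : ℕ) :
    ∃ C : ℝ, 0 < C ∧ ∀ x, ‖x‖ ^ k * ‖lfI χ x‖ ≤ C := by
  obtain ⟨C, hC, h⟩ := (FourierTransformInv.fourierInv χ).decay k 0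
  refine ⟨C * (2 * π) ^ k, by positivity, fun x => ?_⟩
  have h1 := h ((2 * π)⁻¹ • x)
  rw [norm_iteratedFDeriv_zero, SchwartzMap.fourierInv_coe, Real.fourierInv_eq'] at h1
  have e : ∫ (v : Rn n), Complex.exp (↑(2 * π * ⟪v, (2 * π)⁻¹ • x⟫) * Complex.I) • χ v = lfI χ x := by
    rw [lfI]; congr 1; ext v
    rw [inner_smul_right, smul_eq_mul, mul_comm, mul_comm Complex.I]
    congr 4
    field_simp
  rw [e, norm_smul, Real.norm_of_nonneg (by positivity), mul_pow, inv_pow] at h1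
  have : ‖x‖ ^ k * ‖lfI χ x‖ = (((2 * π) ^ k)⁻¹ * ‖x‖ ^ k * ‖lfI χ x‖) * (2 * π) ^ k := by field_simp
  rw [this]; gcongr

lemma schwartz_main {n : ℕ} (χ : SchwartzMap (Rn n) ℂ) (σ : ℝ) (hσ : 0 < σ) (hcs : HasCompactSupport χ)
    (hχ : ∀ ξ, χ ξ ≠ 0 → ‖ξ‖ ^ σ < 1/4) :
    ∃ C : ℝ, 0 < C ∧ ∀ (t : ℝ), 0 < t → ∀ x : Rn n,
      (t ≤ 1 → ‖lfI (fun ξ => lfG t ((‖ξ‖ ^ σ : ℝ) : ℂ) * χ ξ) x‖ ≤ C * t * jap x ^ (-((n:ℝ) + σ))) ∧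
      (1 ≤ t → ‖lfI (fun ξ => lfG t ((‖ξ‖ ^ σ : ℝ) : ℂ) * χ ξ) x‖ ≤
        C * t ^ (-(n:ℝ)/σ) * jap (t ^ (-(1:ℝ)/σ) • x) ^ (-((n:ℝ) + σ))) := by
  obtain ⟨K1, hK1, hd⟩ := lfM_decay χ σ hσ hcs (fun ξ h => (hχ ξ h).le)
  obtain ⟨k, hk⟩ := exists_nat_gt ((n:ℝ) + σ)
  obtain ⟨K2, hK2, hd2⟩ := schwartz_lfI_decay χ k
  obtain ⟨C0, hC0, hC0'⟩ := χ.decay 0 0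
  simp only [pow_zero, one_mul, norm_iteratedFDeriv_zero] at hC0'
  have hχi : Integrable χ := χ.integrable
  set K3 : ℝ := ∫ ξ, ‖χ ξ‖ with hK3
  have hK30 : 0 ≤ K3 := integral_nonneg fun _ => norm_nonneg _
  set K4 : ℝ := 8 * C0 * ∫ ξ : Rn n, Real.exp (-(‖ξ‖ ^ σ / 2)) with hK4
  have hK40 : 0 ≤ K4 := mul_nonneg (by positivity) (integral_nonneg fun _ => (Real.exp_pos _).le)
  refine combine σ hσ (fun t x => lfI (fun ξ => lfG t ((‖ξ‖ ^ σ : ℝ) : ℂ) * χ ξ) x) (K1 + K2 + K3 + K4)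
    (by positivity) ?_ ?_ ?_
  · intro t x ht hx
    have hx0 : x ≠ 0 := norm_pos_iff.1 (by linarith)
    have e : lfI (fun ξ => lfG t ((‖ξ‖ ^ σ : ℝ) : ℂ) * χ ξ) x = lfI (lfM χ σ t) x + lfG t 0 * lfI χ x := by
      rw [lfI, lfI, lfI, ← integral_const_mul, ← integral_add (osc_integrable _ (lfM_integrable χ σ hσ hcs t) x)
        ((osc_integrable _ hχi x).const_mul _)]
      congr 1; ext ξ; rw [lfM]; ring
    rw [e]
    have h1 := hd t x ht.le hx0
    have hG := lfG_b1 t 0 ht.le le_rfl (by norm_num)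
    rw [Complex.ofReal_zero] at hG
    have h2 : ‖lfI χ x‖ ≤ K2 * ‖x‖ ^ (-((n:ℝ) + σ)) := by
      have h3 : ‖lfI χ x‖ ≤ K2 * ‖x‖ ^ (-(k:ℝ)) := by
        rw [Real.rpow_neg (by linarith), Real.rpow_natCast, ← div_eq_mul_inv, le_div_iff₀ (by positivity)]
        have := hd2 x; linarith
      refine h3.trans ?_
      gcongr
    have hP : 0 ≤ t * ‖x‖ ^ (-((n:ℝ) + σ)) := by positivity
    calc _ ≤ ‖lfI (lfM χ σ t) x‖ + ‖lfG t 0‖ * ‖lfI χ x‖ := by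
          rw [← norm_mul]; exact norm_add_le _ _
      _ ≤ K1 * t * ‖x‖ ^ (-((n:ℝ) + σ)) + t * (K2 * ‖x‖ ^ (-((n:ℝ) + σ))) := by gcongr
      _ ≤ _ := by nlinarith [mul_nonneg hK30 hP, mul_nonneg hK40 hP]
  · intro t x ht
    have := lfI_norm_le (fun ξ => lfG t ((‖ξ‖ ^ σ : ℝ) : ℂ) * χ ξ) x (fun ξ => t * ‖χ ξ‖) (hχi.norm.const_mul t) ?_
    · rw [integral_const_mul, ← hK3] at this
      nlinarith [mul_nonneg hK1 ht.le, mul_nonneg hK2.le ht.le, mul_nonneg hK40 ht.le]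
    · intro ξ
      by_cases h0 : χ ξ = 0
      · simp [h0]
      rw [norm_mul]; gcongr
      exact lfG_b1 t _ ht.le (by positivity) (hχ ξ h0)
  · intro t x ht
    obtain ⟨i1, i2⟩ := exp_integral n σ hσ t ht
    have := lfI_norm_le (fun ξ => lfG t ((‖ξ‖ ^ σ : ℝ) : ℂ) * χ ξ) x
      (fun ξ => 8 * C0 * Real.exp (-(t * ‖ξ‖ ^ σ / 2))) (i1.const_mul _) ?_
    · rw [integral_const_mul, i2] at this
      have hT : 0 ≤ t ^ (-(n:ℝ)/σ) := by positivity
      refine this.trans ?_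
      have e : 8 * C0 * (t ^ (-(n:ℝ)/σ) * ∫ ξ : Rn n, Real.exp (-(‖ξ‖ ^ σ / 2))) = K4 * t ^ (-(n:ℝ)/σ) := by
        rw [hK4]; ring
      rw [e]; gcongr; linarith
    · intro ξ
      by_cases h0 : χ ξ = 0
      · simp only [h0, mul_zero, norm_zero]; positivity
      rw [norm_mul]
      calc _ ≤ (8 * Real.exp (-(t * ‖ξ‖ ^ σ / 2))) * C0 := by
            gcongr
            · exact lfG_b2 t _ ht.le (by positivity) (hχ ξ h0)
            · exact hC0' ξ
        _ = _ := by ring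

lemma exists_schwartz_FT {n : ℕ} (ψ : SchwartzMap (Rn n) ℂ) (c : ℝ) (hc : c ≠ 0) :
    ∃ χ : SchwartzMap (Rn n) ℂ, ∀ ξ, χ ξ = FT n ⇑ψ (c • ξ) := by
  have hk : (2 * π)⁻¹ * c ≠ 0 := mul_ne_zero (by positivity) hc
  let e : Rn n ≃L[ℝ] Rn n :=
    (LinearEquiv.smulOfNeZero ℝ (Rn n) ((2 * π)⁻¹ * c) hk).toContinuousLinearEquiv
  have he : ∀ ξ, e ξ = ((2 * π)⁻¹ * c) • ξ := fun ξ => rfl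
  refine ⟨SchwartzMap.compCLMOfContinuousLinearEquiv ℂ e (FourierTransform.fourier ψ), fun ξ => ?_⟩
  rw [SchwartzMap.compCLMOfContinuousLinearEquiv_apply, Function.comp_apply, he,
    SchwartzMap.fourier_coe, Real.fourier_eq', FT]
  congr 1
  ext v
  rw [smul_eq_mul, mul_comm]
  congr 2
  rw [real_inner_smul_right, real_inner_smul_right]
  push_cast
  have : (π:ℂ) ≠ 0 := by exact_mod_cast Real.pi_ne_zero
  field_simp

lemma lf_rad (σ r : ℝ) (hσ : 0 < σ) (hr : 0 ≤ r) (h : r < (2:ℝ) ^ (-(2/σ))) : r ^ σ < 1/4 := by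
  have h1 := Real.rpow_lt_rpow hr h hσ
  rw [← Real.rpow_mul (by norm_num)] at h1
  have : -(2/σ) * σ = ((-2 : ℤ) : ℝ) := by push_cast; field_simp
  rw [this, Real.rpow_intCast] at h1
  norm_num at h1 ⊢
  exact h1

/-- Lemma 3.2, estimate (3.3): pointwise bound for the low-frequency kernel
`𝓕⁻¹(e^{-t/2} L_σ(t,·) ψ̂(2^{2/σ}·))`. Here `ψ` is part of a Littlewood–Paley partition. -/
theorem low_frequency_kernel_pointwise_estimate
    (n : ℕ) (σ : ℝ) (hσ : 0 < σ)
    (ψ φ : SchwartzMap (Rn n) ℂ)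
    (hψsupp : Function.support (FT n ⇑ψ) ⊆ Metric.ball 0 1)
    (hφsupp : Function.support (FT n ⇑φ) ⊆ Metric.ball 0 2 \ Metric.ball 0 (1/2))
    (hpart : ∀ ξ : Rn n, FT n ⇑ψ ξ + ∑' j : ℕ, FT n ⇑φ ((2:ℝ) ^ (-(j:ℤ)) • ξ) = 1) :
    ∃ C : ℝ, 0 < C ∧ ∀ (t : ℝ), 0 < t → ∀ x : Rn n,
      (t ≤ 1 →
        ‖IFT n (fun ξ => ((Real.exp (-(t/2)) * Lsig σ t ξ : ℝ) : ℂ) *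
            FT n ⇑ψ ((2:ℝ) ^ (2/σ) • ξ)) x‖ ≤
          C * t * jap x ^ (-((n:ℝ) + σ))) ∧
      (1 ≤ t →
        ‖IFT n (fun ξ => ((Real.exp (-(t/2)) * Lsig σ t ξ : ℝ) : ℂ) *
            FT n ⇑ψ ((2:ℝ) ^ (2/σ) • ξ)) x‖ ≤
          C * t ^ (-(n:ℝ)/σ) * jap (t ^ (-(1:ℝ)/σ) • x) ^ (-((n:ℝ) + σ))) := by
  have hc : (0:ℝ) < (2:ℝ) ^ (2/σ) := by positivity
  obtain ⟨χ, hχ⟩ := exists_schwartz_FT ψ ((2:ℝ) ^ (2/σ)) hc.ne'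
  have hsm : ∀ ξ, χ ξ ≠ 0 → ‖ξ‖ < (2:ℝ) ^ (-(2/σ)) := by
    intro ξ h
    rw [hχ] at h
    have h1 := hψsupp h
    rw [mem_ball_zero_iff, norm_smul, Real.norm_of_nonneg hc.le] at h1
    rw [Real.rpow_neg (by norm_num), ← one_div, lt_div_iff₀ hc]
    linarith
  have hcs : HasCompactSupport χ := by
    refine HasCompactSupport.intro (isCompact_closedBall (0 : Rn n) ((2:ℝ) ^ (-(2/σ)))) ?_
    intro ξ h
    by_contra h0
    exact h (mem_closedBall_zero_iff.2 (hsm ξ h0).le)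
  obtain ⟨C, hC, H⟩ := schwartz_main χ σ hσ hcs
    (fun ξ h => lf_rad σ _ hσ (norm_nonneg _) (hsm ξ h))
  have key : ∀ t : ℝ, ∀ x : Rn n,
      ‖IFT n (fun ξ => ((Real.exp (-(t/2)) * Lsig σ t ξ : ℝ) : ℂ) *
            FT n ⇑ψ ((2:ℝ) ^ (2/σ) • ξ)) x‖ ≤
        ‖lfI (fun ξ => lfG t ((‖ξ‖ ^ σ : ℝ) : ℂ) * χ ξ) x‖ := by
    intro t x
    have hf : (fun ξ : Rn n => ((Real.exp (-(t/2)) * Lsig σ t ξ : ℝ) : ℂ) *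
            FT n ⇑ψ ((2:ℝ) ^ (2/σ) • ξ)) = fun ξ => lfG t ((‖ξ‖ ^ σ : ℝ) : ℂ) * χ ξ := by
      funext ξ
      rw [← hχ]
      by_cases h : χ ξ = 0
      · simp [h]
      · have h1 := hsm ξ h
        rw [lfG_real _ _ (lf_rad σ _ hσ (norm_nonneg _) h1), Lsig, if_pos h1]
    rw [hf]
    unfold IFT lfI
    rw [norm_mul]
    refine mul_le_of_le_one_left (norm_nonneg _) ?_
    rw [norm_inv, Complex.norm_real, Real.norm_of_nonneg (by positivity)]
    refine inv_le_one_of_one_le₀ (one_le_pow₀ ?_)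
    linarith [Real.pi_gt_three]
  exact ⟨C, hC, fun t ht x => ⟨fun h => (key t x).trans ((H t ht x).1 h),
    fun h => (key t x).trans ((H t ht x).2 h)⟩⟩

end
end

section
/- Let σ ∈ 2ℕ. Then for every positive number j there exists a constant C_j > 0 such that for all t > 0 and all x ∈ ℝⁿ, |𝓕^{−1}( e^{−t/2} L_σ(t,·) ψ̂(2^{2/σ}·) )(x)| ≤ C_j t ⟨x⟩^{−j} if t ≤ 1, and |𝓕^{−1}( e^{−t/2} L_σ(t,·) ψ̂(2^{2/σ}·) )(x)| ≤ C_j t^{−n/σ} ⟨t^{−1/σ} x⟩^{−j} if t ≥ 1. -/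
open MeasureTheory Real Filter
open scoped ENNReal RealInnerProductSpace

noncomputable section

open scoped Nat in
def Sc (m k : ℕ) : ℝ := ((k+m)! : ℝ) / ((k ! : ℝ) * ((2*k+2*m+1)! : ℝ))

def Sf (m : ℕ) (z : ℝ) : ℝ := ∑' k, Sc m k * z ^ k

lemma Sc_nonneg (m k : ℕ) : 0 ≤ Sc m k := by unfold Sc; positivity

open scoped Nat in
lemma fact_aux (k m : ℕ) : (k+m)! * (2*k+m+1)! ≤ k ! * (2*k+2*m+1)! := by
  induction m with
  | zero => simp
  | succ m ih =>
    have e1 : (k+(m+1))! = (k+m+1) * (k+m)! := Nat.factorial_succ _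
    have e2 : (2*k+(m+1)+1)! = (2*k+m+2) * (2*k+m+1)! := by
      rw [show 2*k+(m+1)+1 = (2*k+m+1)+1 by ring, Nat.factorial_succ]
    have e3 : (2*k+2*(m+1)+1)! = (2*k+2*m+3) * ((2*k+2*m+2) * (2*k+2*m+1)!) := by
      rw [show 2*k+2*(m+1)+1 = (2*k+2*m+1)+1+1 by ring, Nat.factorial_succ, Nat.factorial_succ]
    rw [e1, e2, e3]
    calc _ = ((k+m+1) * (2*k+m+2)) * ((k+m)! * (2*k+m+1)!) := by ring
      _ ≤ ((2*k+2*m+2) * (2*k+2*m+3)) * (k ! * (2*k+2*m+1)!) := by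
        refine Nat.mul_le_mul (Nat.mul_le_mul ?_ ?_) ih <;> omega
      _ = _ := by ring

open scoped Nat in
lemma Sc_le (m k : ℕ) : Sc m k ≤ 1 / ((2*k+m+1)! : ℝ) := by
  unfold Sc
  rw [div_le_div_iff₀ (by positivity) (by positivity), one_mul]
  exact_mod_cast fact_aux k m

open scoped Nat in
lemma Sc_le2 (m k : ℕ) : Sc m k ≤ 1 / ((2*k)! : ℝ) := by
  refine (Sc_le m k).trans ?_
  gcongr
  omega

open scoped Nat in
lemma Sc_le3 (m k : ℕ) : Sc m k ≤ 1 / (k ! : ℝ) := by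
  refine (Sc_le m k).trans ?_
  gcongr
  omega

open scoped Nat in
lemma Sc_succ (m k : ℕ) : Sc m (k+1) * (k+1) = Sc (m+1) k := by
  unfold Sc
  rw [show k + 1 + m = k + (m+1) by ring, show 2*(k+1)+2*m+1 = 2*k+2*(m+1)+1 by ring,
    Nat.factorial_succ k]
  push_cast
  field_simp

lemma Sf_summable (m : ℕ) (z : ℝ) : Summable fun k => Sc m k * z ^ k := by
  refine Summable.of_norm_bounded (Real.summable_pow_div_factorial |z|) fun k => ?_
  rw [norm_mul, norm_pow, Real.norm_eq_abs, Real.norm_eq_abs, abs_of_nonneg (Sc_nonneg m k)]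
  have := mul_le_mul_of_nonneg_right (Sc_le3 m k) (pow_nonneg (abs_nonneg z) k)
  calc _ ≤ _ := this
    _ = _ := by ring

lemma Sf_hasDerivAt (m : ℕ) (z : ℝ) : HasDerivAt (Sf m) (Sf (m+1) z) z := by
  set R := |z| + 1 with hR
  have hR0 : 0 ≤ R := by positivity
  have hu : Summable fun k : ℕ => Sc m k * (k * R ^ (k-1)) := by
    rw [← summable_nat_add_iff 1]
    refine (Sf_summable (m+1) R).congr fun k => ?_
    rw [← Sc_succ]; push_cast [Nat.add_sub_cancel]; ring
  have key := hasDerivAt_tsum_of_isPreconnected (𝕜 := ℝ) (g := fun k y => Sc m k * y ^ k)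
    (g' := fun k y => Sc m k * (k * y ^ (k-1))) (t := Metric.ball 0 R) (y₀ := z) (y := z)
    hu Metric.isOpen_ball (convex_ball _ _).isPreconnected
    (fun k y _ => (hasDerivAt_pow k y).const_mul _) ?_ ?_ (Sf_summable m z) ?_
  · have e : ∑' k : ℕ, Sc m k * (k * z ^ (k-1)) = Sf (m+1) z := by
      have hs : Summable fun k : ℕ => Sc m k * (k * z ^ (k-1)) := by
        rw [← summable_nat_add_iff 1]
        refine (Sf_summable (m+1) z).congr fun k => ?_
        rw [← Sc_succ]; push_cast [Nat.add_sub_cancel]; ring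
      rw [hs.tsum_eq_zero_add]
      unfold Sf
      simp only [Nat.cast_zero, zero_mul, mul_zero, zero_add]
      refine tsum_congr fun k => ?_
      rw [← Sc_succ]; push_cast [Nat.add_sub_cancel]; ring
    rw [e] at key
    exact key
  · intro k y hy
    rw [mem_ball_zero_iff] at hy
    rw [norm_mul, norm_mul, norm_pow, Real.norm_of_nonneg (Sc_nonneg m k)]
    simp only [RCLike.norm_natCast]
    have := Sc_nonneg m k
    gcongr
  · simp [hR]
  · simp [hR]

lemma Sf_sinh (y : ℝ) : Sf 0 (y^2) * y = Real.sinh y := by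
  rw [Real.sinh_eq_tsum, Sf, ← tsum_mul_right]
  refine tsum_congr fun k => ?_
  unfold Sc
  simp only [add_zero, mul_zero]
  field_simp
  ring

lemma Sf_nonneg (m : ℕ) {z : ℝ} (hz : 0 ≤ z) : 0 ≤ Sf m z :=
  tsum_nonneg fun k => mul_nonneg (Sc_nonneg m k) (pow_nonneg hz k)

lemma Sf_le_aux (m p : ℕ) (hp : ∀ k, Sc m k ≤ 1 / ((2*k+p).factorial : ℝ)) {y : ℝ} (hy : 0 ≤ y) :
    y ^ p * Sf m (y^2) ≤ Real.exp y := by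
  rw [Sf, ← tsum_mul_left]
  have hinj : Function.Injective (fun k : ℕ => 2*k+p) := fun a b h => by
    simp at h; exact h
  have hs := Real.summable_pow_div_factorial y
  have hs2 := hs.comp_injective hinj
  have hexp : Real.exp y = ∑' n : ℕ, y ^ n / (n.factorial : ℝ) := by
    rw [Real.exp_eq_exp_ℝ, NormedSpace.exp_eq_tsum_div]
  calc _ ≤ ∑' k : ℕ, y ^ (2*k+p) / ((2*k+p).factorial : ℝ) := by
        refine Summable.tsum_le_tsum (fun k => ?_) ((Sf_summable m (y^2)).mul_left _) hs2
        have := mul_le_mul_of_nonneg_left (hp k) (pow_nonneg hy (2*k+p))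
        calc _ = y ^ (2*k+p) * Sc m k := by ring
          _ ≤ _ := this
          _ = _ := by ring
    _ ≤ _ := by
        rw [hexp]
        exact hs2.tsum_le_tsum_of_inj (fun k : ℕ => 2*k+p) hinj (fun n _ => by positivity)
          (fun k => le_rfl) hs

lemma Sf_le (m : ℕ) {y : ℝ} (hy : 0 ≤ y) : Sf m (y^2) ≤ Real.exp y := by
  simpa using Sf_le_aux m 0 (Sc_le2 m) hy

lemma Sf_le' (m : ℕ) {y : ℝ} (hy : 0 ≤ y) : y ^ (m+1) * Sf m (y^2) ≤ Real.exp y :=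
  Sf_le_aux m (m+1) (Sc_le m) hy

lemma Sf_le_comb (m : ℕ) {y : ℝ} (hy : 0 ≤ y) :
    (1 + y) ^ (m+1) * Sf m (y^2) ≤ 2 ^ (m+1) * Real.exp y := by
  have h1 := Sf_le m hy
  have h2 := Sf_le' m hy
  have h3 : (1 + y) ^ (m+1) ≤ 2 ^ m * (1 ^ (m+1) + y ^ (m+1)) := by
    simpa using add_pow_le (zero_le_one) hy (m+1)
  have h0 := Sf_nonneg m (sq_nonneg y)
  calc _ ≤ 2 ^ m * (1 ^ (m+1) + y ^ (m+1)) * Sf m (y^2) := by gcongr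
    _ = 2 ^ m * (Sf m (y^2) + y ^ (m+1) * Sf m (y^2)) := by ring
    _ ≤ 2 ^ m * (Real.exp y + Real.exp y) := by gcongr
    _ = _ := by ring

lemma poly_exp (M : ℕ) {a : ℝ} (ha : 0 ≤ a) :
    a ^ M ≤ 2 ^ M * M.factorial * Real.exp (a/2) := by
  have h := Real.pow_div_factorial_le_exp (x := a/2) (by positivity) M
  rw [div_le_iff₀ (by positivity), div_pow, div_le_iff₀ (by positivity)] at h
  linarith

lemma G_bound_large (m : ℕ) {t s : ℝ} (ht : 1 ≤ t) (hs : 0 ≤ s) (hst : s ≤ t/4) :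
    Real.exp (-(t/2)) * t * (t ^ m * Sf m (t^2/4 - t*s)) ≤
      (32 ^ (m+1) * (m+1).factorial * Real.exp (1/2)) * Real.exp (-(s/2)) := by
  have hz : 0 ≤ t^2/4 - t*s := by nlinarith
  set y := Real.sqrt (t^2/4 - t*s) with hy
  have hy0 : 0 ≤ y := Real.sqrt_nonneg _
  have hy2 : y^2 = t^2/4 - t*s := Real.sq_sqrt hz
  have hyle : y ≤ t/2 - s := by
    apply Real.sqrt_le_iff.2 ⟨by linarith, by nlinarith⟩
  have htle : t ≤ 8 * (1+s) * (1+y) := by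
    rcases le_total (t/8) s with h | h
    · nlinarith
    · have : t ≤ 3 * y := by
        apply le_of_sq_le_sq _ (by positivity)
        nlinarith
      nlinarith
  rw [← hy2]
  have h0 := Sf_nonneg m (sq_nonneg y)
  have hc := Sf_le_comb m hy0
  have hp := poly_exp (m+1) (a := 1+s) (by positivity)
  calc _ = Real.exp (-(t/2)) * (t ^ (m+1) * Sf m (y^2)) := by ring
    _ ≤ Real.exp (-(t/2)) * ((8 * (1+s) * (1+y)) ^ (m+1) * Sf m (y^2)) := by gcongr
    _ = Real.exp (-(t/2)) * (8 ^ (m+1) * (1+s) ^ (m+1) * ((1+y) ^ (m+1) * Sf m (y^2))) := by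
      rw [mul_pow, mul_pow]; ring
    _ ≤ Real.exp (-(t/2)) * (8 ^ (m+1) * (2 ^ (m+1) * (m+1).factorial * Real.exp ((1+s)/2)) *
        (2 ^ (m+1) * Real.exp (t/2 - s))) := by
      have hc' := hc.trans (mul_le_mul_of_nonneg_left (Real.exp_le_exp.2 hyle)
        (by positivity : (0:ℝ) ≤ 2 ^ (m+1)))
      have : 0 ≤ (1+y) ^ (m+1) * Sf m (y^2) := by positivity
      refine mul_le_mul_of_nonneg_left (mul_le_mul (mul_le_mul_of_nonneg_left hp (by positivity)) hc'
        this (by positivity)) (Real.exp_pos _).le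
    _ = (8 ^ (m+1) * 2 ^ (m+1) * 2 ^ (m+1)) * (m+1).factorial *
        (Real.exp (-(t/2)) * Real.exp ((1+s)/2) * Real.exp (t/2 - s)) := by ring
    _ = _ := by
      rw [← mul_pow, ← mul_pow, ← Real.exp_add, ← Real.exp_add, mul_assoc _ (Real.exp (1/2)),
        ← Real.exp_add]
      norm_num
      left; ring

lemma G_bound_small (m : ℕ) {t s : ℝ} (ht0 : 0 < t) (ht : t ≤ 1) (hs : 0 ≤ s) (hst : s ≤ 1/4) :
    Real.exp (-(t/2)) * ((t^2) ^ m * Sf m (t^2/4 - t^2*s)) ≤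
      Real.exp 1 * Real.exp (-(s/2)) := by
  have hz : 0 ≤ t^2/4 - t^2*s := by nlinarith [sq_nonneg t]
  set y := Real.sqrt (t^2/4 - t^2*s) with hy
  have hy0 : 0 ≤ y := Real.sqrt_nonneg _
  have hy2 : y^2 = t^2/4 - t^2*s := Real.sq_sqrt hz
  have hyle : y ≤ t/2 := by
    apply Real.sqrt_le_iff.2 ⟨by linarith, by nlinarith [sq_nonneg t]⟩
  rw [← hy2]
  have h1 := Sf_le m hy0
  have h0 := Sf_nonneg m (sq_nonneg y)
  have h2 : (t^2)^m ≤ 1 := pow_le_one₀ (by positivity) (pow_le_one₀ ht0.le ht)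
  calc _ ≤ Real.exp (-(t/2)) * (1 * Real.exp (t/2)) := by
        gcongr
        exact h1.trans (by gcongr)
    _ = 1 := by rw [one_mul, ← Real.exp_add]; simp
    _ ≤ _ := by
      rw [← Real.exp_add]; apply Real.one_le_exp; linarith

lemma G_contDiff (G : ℕ → ℝ → ℝ) (hG : ∀ m s, HasDerivAt (G m) (G (m+1) s) s) (N m : ℕ) :
    ContDiff ℝ N (G m) := by
  induction N generalizing m with
  | zero =>
    exact contDiff_zero.2 (continuous_iff_continuousAt.2 fun s => (hG m s).continuousAt)
  | succ N ih =>
    push_cast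
    rw [contDiff_succ_iff_deriv]
    refine ⟨fun s => (hG m s).differentiableAt, by simp, ?_⟩
    rw [show deriv (G m) = G (m+1) from funext fun s => (hG m s).deriv]
    exact ih (m+1)

lemma G_iter (G : ℕ → ℝ → ℝ) (hG : ∀ m s, HasDerivAt (G m) (G (m+1) s) s) (m : ℕ) :
    iteratedDeriv m (G 0) = G m := by
  induction m with
  | zero => simp
  | succ m ih =>
    rw [iteratedDeriv_succ, ih]
    exact funext fun s => (hG m s).deriv

lemma exp_decay (k M : ℕ) (hk : 0 < k) {r : ℝ} (hr : 0 ≤ r) :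
    Real.exp (-(r^(2*k)/2)) * (1 + r) ^ M ≤ 2 ^ M * M.factorial * Real.exp 1 := by
  have h1 : 1 + r ≤ 2 + r^(2*k) := by
    rcases le_total r 1 with h | h
    · have : 0 ≤ r^(2*k) := by positivity
      linarith
    · have : r ≤ r^(2*k) := le_self_pow₀ h (by omega)
      linarith
  have h2 := poly_exp M (a := 2 + r^(2*k)) (by positivity)
  calc _ ≤ Real.exp (-(r^(2*k)/2)) * (2 + r^(2*k)) ^ M := by gcongr
    _ ≤ Real.exp (-(r^(2*k)/2)) * (2 ^ M * M.factorial * Real.exp ((2 + r^(2*k))/2)) := by gcongr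
    _ = 2 ^ M * M.factorial * (Real.exp (-(r^(2*k)/2)) * Real.exp ((2 + r^(2*k))/2)) := by ring
    _ = _ := by rw [← Real.exp_add]; congr 2; ring

lemma symbol_smooth {n : ℕ} (k N : ℕ) (χ : SchwartzMap (Rn n) ℂ) (G : ℕ → ℝ → ℝ)
    (hG : ∀ m s, HasDerivAt (G m) (G (m+1) s) s) (μ : ℝ) :
    ContDiff ℝ N (fun η : Rn n => G 0 (‖η‖^(2*k)) • χ (μ • η)) := by
  have h1 : ContDiff ℝ N (fun η : Rn n => ‖η‖^(2*k)) := by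
    simp_rw [pow_mul]; exact (contDiff_norm_sq ℝ).pow k
  have h2 : ContDiff ℝ N (fun η : Rn n => χ (μ • η)) :=
    (χ.smooth N).comp (contDiff_const_smul μ)
  exact ((G_contDiff G hG N 0).comp h1).smul h2

lemma symbol_bound (n k N : ℕ) (hk : 0 < k) (χ : SchwartzMap (Rn n) ℂ)
    (hχ : ∀ ξ, χ ξ ≠ 0 → ‖ξ‖^(2*k) < 1/4) (A : ℝ) (hA : 0 ≤ A) :
    ∃ K : ℝ, 0 ≤ K ∧ ∀ (G : ℕ → ℝ → ℝ) (_ : ∀ m s, HasDerivAt (G m) (G (m+1) s) s)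
      (μ : ℝ) (_ : 0 < μ) (_ : μ ≤ 1)
      (_ : ∀ m ≤ N, ∀ s, 0 ≤ s → μ^(2*k) * s ≤ 1/4 → |G m s| ≤ A * Real.exp (-(s/2))),
      ∀ q ≤ N, ∀ η : Rn n,
        ‖iteratedFDeriv ℝ q (fun η : Rn n => G 0 (‖η‖^(2*k)) • χ (μ • η)) η‖ ≤
          K * (1 + ‖η‖) ^ (-((n:ℝ)+1)) := by
  have hT : Function.HasTemperateGrowth (fun η : Rn n => ‖η‖^(2*k)) := by
    simp_rw [pow_mul]
    exact (Function.hasTemperateGrowth_norm_sq (H := Rn n)).pow k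
  obtain ⟨p, C, hC, hCb⟩ := hT.norm_iteratedFDeriv_le_uniform N
  have hB : ∃ B : ℝ, 0 ≤ B ∧ ∀ q ≤ N, ∀ ξ, ‖iteratedFDeriv ℝ q χ ξ‖ ≤ B := by
    refine ⟨∑ q ∈ Finset.range (N+1), SchwartzMap.seminorm ℝ 0 q χ,
      Finset.sum_nonneg fun _ _ => apply_nonneg _ _, fun q hq ξ => ?_⟩
    refine (χ.norm_iteratedFDeriv_le_seminorm ℝ q ξ).trans ?_
    exact Finset.single_le_sum (f := fun q => SchwartzMap.seminorm ℝ 0 q χ)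
      (fun _ _ => apply_nonneg _ _) (Finset.mem_range.2 (by omega))
  obtain ⟨B, hB0, hB⟩ := hB
  set M := p * N + (n+1) with hM
  refine ⟨2 ^ N * (N.factorial * A * (1+C)^N * B) * (2 ^ M * M.factorial * Real.exp 1),
    by positivity, ?_⟩
  intro G hG μ hμ0 hμ1 hbd q hq η
  have hf1 : ContDiff ℝ N (fun η : Rn n => ‖η‖^(2*k)) := by
    simp_rw [pow_mul]; exact (contDiff_norm_sq ℝ).pow k
  have hf : ContDiff ℝ N (fun η : Rn n => G 0 (‖η‖^(2*k))) := (G_contDiff G hG N 0).comp hf1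
  have hg : ContDiff ℝ N (fun η : Rn n => χ (μ • η)) :=
    (χ.smooth N).comp (contDiff_const_smul μ)
  have h1 := norm_iteratedFDeriv_smul_le hf hg η (n := q) (by exact_mod_cast hq)
  refine h1.trans ?_
  have hrpow : (1 + ‖η‖) ^ (-((n:ℝ)+1)) = ((1 + ‖η‖) ^ (n+1))⁻¹ := by
    rw [Real.rpow_neg (by positivity)]
    norm_cast
  have hE0 : 0 ≤ ‖η‖ := norm_nonneg _
  have hE : Real.exp (-(‖η‖^(2*k)/2)) * ((1 + ‖η‖) ^ p) ^ N ≤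
      (2 ^ M * M.factorial * Real.exp 1) * (1 + ‖η‖) ^ (-((n:ℝ)+1)) := by
    rw [hrpow, ← div_eq_mul_inv, le_div_iff₀ (by positivity), ← pow_mul, mul_assoc, ← pow_add]
    exact exp_decay k M hk hE0
  by_cases hη : μ^(2*k) * ‖η‖^(2*k) ≤ 1/4
  · have hterm : ∀ i ∈ Finset.range (q+1),
        (q.choose i : ℝ) * ‖iteratedFDeriv ℝ i (fun η : Rn n => G 0 (‖η‖^(2*k))) η‖ *
          ‖iteratedFDeriv ℝ (q - i) (fun η : Rn n => χ (μ • η)) η‖ ≤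
        (q.choose i : ℝ) * ((N.factorial * A * (1+C)^N * B) *
          (Real.exp (-(‖η‖^(2*k)/2)) * ((1 + ‖η‖) ^ p) ^ N)) := by
      intro i hi
      have hiq : i ≤ q := by simpa [Nat.lt_succ_iff] using hi
      have hiN : i ≤ N := hiq.trans hq
      have hD1 : 1 ≤ (1+C) * (1 + ‖η‖)^p := by
        have : 1 ≤ (1 + ‖η‖)^p := one_le_pow₀ (by linarith)
        nlinarith
      have hcomp := norm_iteratedFDeriv_comp_le (𝕜 := ℝ) (g := G 0)
        (f := fun η : Rn n => ‖η‖^(2*k)) (n := i) (N := N) (G_contDiff G hG N 0) hf1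
        (by exact_mod_cast hiN) η (C := A * Real.exp (-(‖η‖^(2*k)/2)))
        (D := (1+C) * (1 + ‖η‖)^p) ?_ ?_
      · have hχb : ‖iteratedFDeriv ℝ (q - i) (fun η : Rn n => χ (μ • η)) η‖ ≤ B := by
          rw [iteratedFDeriv_comp_const_smul μ (χ.smooth _), norm_smul, norm_pow,
            Real.norm_of_nonneg hμ0.le]
          calc _ ≤ 1 * B := mul_le_mul (pow_le_one₀ hμ0.le hμ1) (hB _ (by omega) _)
                (norm_nonneg _) zero_le_one
            _ = B := one_mul B
        have hcomp' : ‖iteratedFDeriv ℝ i (fun η : Rn n => G 0 (‖η‖^(2*k))) η‖ ≤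
            N.factorial * (A * Real.exp (-(‖η‖^(2*k)/2))) * ((1+C) * (1 + ‖η‖)^p)^N := by
          refine hcomp.trans ?_
          gcongr
        rw [mul_assoc]
        refine mul_le_mul_of_nonneg_left ?_ (by positivity)
        refine (mul_le_mul hcomp' hχb (norm_nonneg _) (by positivity)).trans (le_of_eq ?_)
        rw [mul_pow]; ring
      · intro l hl
        rw [norm_iteratedFDeriv_eq_norm_iteratedDeriv, G_iter G hG, Real.norm_eq_abs]
        exact hbd l (hl.trans hiN) _ (by positivity) hη
      · intro l hl1 hl
        calc _ ≤ C * (1 + ‖η‖)^p := hCb l (hl.trans hiN) η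
          _ ≤ (1+C) * (1 + ‖η‖)^p := by gcongr; linarith
          _ ≤ _ := le_self_pow₀ hD1 (by omega)
    refine (Finset.sum_le_sum hterm).trans ?_
    rw [← Finset.sum_mul]
    have hch : ∑ i ∈ Finset.range (q+1), (q.choose i : ℝ) = 2 ^ q := by
      exact_mod_cast Nat.sum_range_choose q
    rw [hch]
    calc _ ≤ 2 ^ N * ((N.factorial * A * (1+C)^N * B) *
          ((2 ^ M * M.factorial * Real.exp 1) * (1 + ‖η‖) ^ (-((n:ℝ)+1)))) := by
          gcongr
          norm_num
      _ = _ := by ring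
  · have hzero : ∀ l, iteratedFDeriv ℝ l (fun η : Rn n => χ (μ • η)) η = 0 := by
      intro l
      have hopen : IsOpen {η : Rn n | 1/4 < μ^(2*k) * ‖η‖^(2*k)} :=
        isOpen_lt continuous_const (by fun_prop)
      have hev : (fun η : Rn n => χ (μ • η)) =ᶠ[nhds η] fun _ => 0 := by
        filter_upwards [hopen.mem_nhds (not_le.1 hη)] with y hy
        by_contra hne
        have := hχ _ hne
        rw [norm_smul, mul_pow, Real.norm_of_nonneg hμ0.le] at this
        exact absurd hy (not_lt.2 this.le)
      rw [(hev.iteratedFDeriv ℝ l).eq_of_nhds]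
      simp
    simp only [hzero, norm_zero, mul_zero, Finset.sum_const_zero]
    positivity

lemma one_le_jap {n : ℕ} (x : Rn n) : 1 ≤ jap x := by
  unfold jap; rw [Real.one_le_sqrt]; nlinarith [sq_nonneg ‖x‖]

lemma jap_le {n : ℕ} (x : Rn n) : jap x ≤ 1 + ‖x‖ := by
  unfold jap
  rw [Real.sqrt_le_iff]
  constructor
  · positivity
  · nlinarith [norm_nonneg x]

set_option maxHeartbeats 1000000 in
open FourierTransform in
lemma kernel_bound (n k : ℕ) (j : ℝ) (N : ℕ) (hjN : j ≤ N) (hk : 0 < k) (χ : SchwartzMap (Rn n) ℂ)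
    (hχ : ∀ ξ, χ ξ ≠ 0 → ‖ξ‖^(2*k) < 1/4) (A : ℝ) (hA : 0 ≤ A) :
    ∃ K : ℝ, 0 < K ∧ ∀ (G : ℕ → ℝ → ℝ) (_ : ∀ m s, HasDerivAt (G m) (G (m+1) s) s)
      (μ : ℝ) (_ : 0 < μ) (_ : μ ≤ 1)
      (_ : ∀ m ≤ N, ∀ s, 0 ≤ s → μ^(2*k) * s ≤ 1/4 → |G m s| ≤ A * Real.exp (-(s/2))),
      ∀ x : Rn n,
        ‖∫ η : Rn n, (G 0 (‖η‖^(2*k)) • χ (μ • η)) * Complex.exp (Complex.I * (⟪η, x⟫ : ℝ))‖ ≤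
          K * jap x ^ (-j) := by
  obtain ⟨K, hK0, hK⟩ := symbol_bound n k N hk χ hχ A hA
  have hint : Integrable (fun η : Rn n => (1 + ‖η‖) ^ (-((n:ℝ)+1))) :=
    integrable_one_add_norm (by simp)
  set J := ∫ η : Rn n, (1 + ‖η‖) ^ (-((n:ℝ)+1)) with hJ
  have hJ0 : 0 ≤ J := integral_nonneg fun η => by positivity
  refine ⟨2 ^ N * (1 + (2*π)^N) * (2 ^ N * ((N+1) * (K * J))) + 1, by positivity, ?_⟩
  intro G hG μ hμ0 hμ1 hbd x
  set f := fun η : Rn n => G 0 (‖η‖^(2*k)) • χ (μ • η) with hf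
  have hsm : ContDiff ℝ N f := symbol_smooth k N χ G hG μ
  have hfb : ∀ q ≤ N, ∀ η, ‖iteratedFDeriv ℝ q f η‖ ≤ K * (1 + ‖η‖) ^ (-((n:ℝ)+1)) :=
    hK G hG μ hμ0 hμ1 hbd
  have hfi : ∀ q ≤ N, Integrable (fun η => ‖iteratedFDeriv ℝ q f η‖) := by
    intro q hq
    refine (hint.const_mul K).mono'
      ((hsm.continuous_iteratedFDeriv (by exact_mod_cast hq)).norm.aestronglyMeasurable) ?_
    exact Eventually.of_forall fun η => by simpa using hfb q hq η
  have hfI : ∀ q ≤ N, ∫ η, ‖iteratedFDeriv ℝ q f η‖ ≤ K * J := by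
    intro q hq
    rw [hJ, ← integral_const_mul]
    exact integral_mono (hfi q hq) (hint.const_mul K) (hfb q hq)
  set w : Rn n := (-(2*π)⁻¹) • x with hw
  have heq : ∫ η : Rn n, f η * Complex.exp (Complex.I * (⟪η, x⟫ : ℝ)) = 𝓕 f w := by
    rw [Real.fourier_eq']
    refine integral_congr_ae (Eventually.of_forall fun η => ?_)
    simp only [smul_eq_mul]
    rw [mul_comm (f η)]
    congr 2
    rw [hw, real_inner_smul_right]
    have : -2 * π * (-(2*π)⁻¹ * ⟪η, x⟫) = ⟪η, x⟫ := by field_simp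
    rw [this, mul_comm]
  rw [heq]
  have hmain : ∀ q ≤ N, ‖w‖^q * ‖𝓕 f w‖ ≤ 2 ^ N * ((N+1) * (K * J)) := by
    intro q hq
    have := pow_mul_norm_iteratedFDeriv_fourier_le (K := 0) (N := (N:ℕ∞)) (f := f)
      (by exact_mod_cast hsm)
      (fun k' n' hk' hn' => by
        have : k' = 0 := by simpa using hk'
        subst this
        simpa using hfi n' (by exact_mod_cast hn')) (k := 0) (n := q) (by simp)
      (by exact_mod_cast hq) w
    simp only [norm_iteratedFDeriv_zero] at this
    refine this.trans ?_
    rw [Finset.sum_product]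
    simp only [zero_add, Finset.range_one, Finset.sum_singleton, pow_zero, one_mul,
      Nat.cast_zero, mul_zero]
    have hs : ∑ q' ∈ Finset.range (q+1), ∫ η, ‖iteratedFDeriv ℝ q' f η‖ ≤ (N+1) * (K*J) := by
      refine (Finset.sum_le_sum (g := fun _ => K * J) fun i hi => hfI i ?_).trans ?_
      · have := Finset.mem_range.1 hi; omega
      · simp only [Finset.sum_const, Finset.card_range, nsmul_eq_mul]
        push_cast
        gcongr
    have h0 : 0 ≤ ∑ q' ∈ Finset.range (q+1), ∫ η, ‖iteratedFDeriv ℝ q' f η‖ :=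
      Finset.sum_nonneg fun i _ => integral_nonneg fun η => norm_nonneg _
    refine mul_le_mul (pow_le_pow_right₀ (by norm_num) hq) hs h0 (by positivity)
  have hT0 : 0 ≤ 2 ^ N * (((N:ℝ)+1) * (K * J)) := by positivity
  generalize 2 ^ N * (((N:ℝ)+1) * (K * J)) = T at hmain hT0 ⊢
  have h1 := hmain 0 (Nat.zero_le _)
  rw [pow_zero, one_mul] at h1
  have h2 := hmain N le_rfl
  have hxw : ‖x‖ = 2*π*‖w‖ := by
    rw [hw, norm_smul, norm_neg, norm_inv, Real.norm_of_nonneg (by positivity)]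
    field_simp
  have h3 : (1 + ‖x‖)^N * ‖𝓕 f w‖ ≤ 2 ^ N * (1 + (2*π)^N) * T := by
    have : (1 + ‖x‖)^N ≤ 2 ^ N * (1 + ‖x‖^N) := by
      refine (add_pow_le zero_le_one (norm_nonneg x) N).trans ?_
      rw [one_pow]
      gcongr
      · norm_num
      · omega
    calc _ ≤ 2 ^ N * (1 + ‖x‖^N) * ‖𝓕 f w‖ := by gcongr
      _ = 2 ^ N * (‖𝓕 f w‖ + (2*π)^N * (‖w‖^N * ‖𝓕 f w‖)) := by rw [hxw, mul_pow]; ring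
      _ ≤ 2 ^ N * (T + (2*π)^N * T) := by gcongr
      _ = _ := by ring
  have hj1 := one_le_jap x
  rw [Real.rpow_neg (by linarith), ← div_eq_mul_inv, le_div_iff₀ (by positivity)]
  have h4 : jap x ^ j ≤ (1 + ‖x‖)^N := by
    calc jap x ^ j ≤ jap x ^ (N:ℝ) := Real.rpow_le_rpow_of_exponent_le hj1 hjN
      _ = jap x ^ N := Real.rpow_natCast _ _
      _ ≤ _ := by gcongr; exact jap_le x
  calc _ ≤ ‖𝓕 f w‖ * (1 + ‖x‖)^N := by gcongr
    _ ≤ _ := by linarith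

lemma IFT_norm_le (n : ℕ) (f : Rn n → ℂ) (x : Rn n) :
    ‖IFT n f x‖ ≤ ‖∫ ξ, f ξ * Complex.exp (Complex.I * (⟪ξ, x⟫ : ℝ))‖ := by
  unfold IFT
  rw [norm_mul]
  refine mul_le_of_le_one_left (norm_nonneg _) ?_
  rw [norm_inv, Complex.norm_real, Real.norm_of_nonneg (by positivity)]
  apply inv_le_one_of_one_le₀
  apply one_le_pow₀
  nlinarith [Real.pi_gt_three]

open FourierTransform in
lemma FT_eq (n : ℕ) (f : Rn n → ℂ) (ξ : Rn n) : FT n f ξ = 𝓕 f ((2*π)⁻¹ • ξ) := by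
  unfold FT
  rw [Real.fourier_eq']
  refine integral_congr_ae (Eventually.of_forall fun η => ?_)
  simp only [smul_eq_mul]
  rw [mul_comm (f η)]
  congr 2
  rw [real_inner_smul_right]
  have : -2 * π * ((2*π)⁻¹ * ⟪η, ξ⟫) = -⟪η, ξ⟫ := by field_simp
  rw [this]; push_cast; ring

open FourierTransform in
lemma exists_chi (n : ℕ) (ψ : SchwartzMap (Rn n) ℂ) (c : ℝ) (hc : 0 < c) :
    ∃ χ : SchwartzMap (Rn n) ℂ, ∀ ξ, χ ξ = FT n ⇑ψ (c • ξ) := by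
  have hc' : (2*π)⁻¹ * c ≠ 0 := by positivity
  refine ⟨SchwartzMap.compCLMOfContinuousLinearEquiv ℝ
    (ContinuousLinearEquiv.smulLeft (M₁ := Rn n) (R₁ := ℝ) (Units.mk0 _ hc')) (𝓕 ψ), fun ξ => ?_⟩
  rw [FT_eq, smul_smul, SchwartzMap.compCLMOfContinuousLinearEquiv_apply]
  rfl

lemma Lsig_eq {n : ℕ} (k : ℕ) (hk : 0 < k) (t : ℝ) (ξ : Rn n)
    (h : ‖ξ‖ < (2:ℝ) ^ (-(2/(2*(k:ℝ))))) (h' : ‖ξ‖^(2*k) < 1/4) :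
    Lsig (2*(k:ℝ)) t ξ = t * Sf 0 (t^2/4 - t^2*‖ξ‖^(2*k)) := by
  unfold Lsig
  rw [if_pos h]
  have e : ‖ξ‖ ^ (2*(k:ℝ)) = ‖ξ‖^(2*k) := by
    rw [← Real.rpow_natCast]; push_cast; rfl
  rw [e]
  have hp : 0 < 1/4 - ‖ξ‖^(2*k) := by linarith
  have hs : 0 < Real.sqrt (1/4 - ‖ξ‖^(2*k)) := Real.sqrt_pos.2 hp
  rw [← Sf_sinh, div_eq_iff hs.ne', mul_pow, Real.sq_sqrt hp.le]
  rw [show t^2 * (1/4 - ‖ξ‖^(2*k)) = t^2/4 - t^2*‖ξ‖^(2*k) by ring]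
  ring

lemma G_hasDerivAt (c a b : ℝ) (m : ℕ) (s : ℝ) :
    HasDerivAt (fun s => c * ((-b)^m * Sf m (a - b*s))) (c * ((-b)^(m+1) * Sf (m+1) (a - b*s))) s := by
  have h1 : HasDerivAt (fun s => a - b*s) (-b) s := by
    simpa using ((hasDerivAt_id s).const_mul b).const_sub a
  have h2 := (Sf_hasDerivAt m (a - b*s)).comp s h1
  have h3 := (h2.const_mul ((-b)^m)).const_mul c
  exact h3.congr_deriv (by ring)

/-- Lemma 3.2, estimate (3.4): for `σ ∈ 2ℕ`, pointwise bound of arbitrary polynomial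
decay order `j` for the low-frequency kernel `𝓕⁻¹(e^{-t/2} L_σ(t,·) ψ̂(2^{2/σ}·))`. -/
theorem low_frequency_kernel_pointwise_estimate_even
    (n : ℕ) (σ : ℝ) (hσ : ∃ k : ℕ, 0 < k ∧ σ = 2 * k)
    (ψ φ : SchwartzMap (Rn n) ℂ)
    (hψsupp : Function.support (FT n ⇑ψ) ⊆ Metric.ball 0 1)
    (hφsupp : Function.support (FT n ⇑φ) ⊆ Metric.ball 0 2 \ Metric.ball 0 (1/2))
    (hpart : ∀ ξ : Rn n, FT n ⇑ψ ξ + ∑' j : ℕ, FT n ⇑φ ((2:ℝ) ^ (-(j:ℤ)) • ξ) = 1) :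
    ∀ j : ℝ, 0 < j → ∃ C : ℝ, 0 < C ∧ ∀ (t : ℝ), 0 < t → ∀ x : Rn n,
      (t ≤ 1 →
        ‖IFT n (fun ξ => ((Real.exp (-(t/2)) * Lsig σ t ξ : ℝ) : ℂ) *
            FT n ⇑ψ ((2:ℝ) ^ (2/σ) • ξ)) x‖ ≤
          C * t * jap x ^ (-j)) ∧
      (1 ≤ t →
        ‖IFT n (fun ξ => ((Real.exp (-(t/2)) * Lsig σ t ξ : ℝ) : ℂ) *
            FT n ⇑ψ ((2:ℝ) ^ (2/σ) • ξ)) x‖ ≤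
          C * t ^ (-(n:ℝ)/σ) * jap (t ^ (-(1:ℝ)/σ) • x) ^ (-j)) := by
  obtain ⟨k, hk, rfl⟩ := hσ
  intro j hj
  obtain ⟨N, hN⟩ := exists_nat_ge j
  have hkR : (0:ℝ) < k := by exact_mod_cast hk
  set c : ℝ := (2:ℝ) ^ (2/(2*(k:ℝ))) with hc
  have hc0 : 0 < c := by positivity
  have hcinv : (2:ℝ) ^ (-(2/(2*(k:ℝ)))) = c⁻¹ := Real.rpow_neg (by norm_num) _
  have hck : c ^ (2*k) = 4 := by
    rw [hc, ← Real.rpow_natCast, ← Real.rpow_mul (by norm_num)]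
    push_cast
    rw [div_mul_cancel₀ _ (by positivity)]
    norm_num
  obtain ⟨χ, hχe⟩ := exists_chi n ψ c hc0
  have hχ1 : ∀ ξ, χ ξ ≠ 0 → ‖ξ‖ < c⁻¹ := by
    intro ξ hξ
    rw [hχe] at hξ
    have := hψsupp hξ
    rw [mem_ball_zero_iff, norm_smul, Real.norm_of_nonneg hc0.le] at this
    rw [inv_eq_one_div, lt_div_iff₀ hc0]
    linarith
  have hχ2 : ∀ ξ, χ ξ ≠ 0 → ‖ξ‖^(2*k) < 1/4 := by
    intro ξ hξ
    have := pow_lt_pow_left₀ (hχ1 ξ hξ) (norm_nonneg _) (n := 2*k) (by omega)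
    rw [inv_pow, hck] at this
    linarith
  have hfun : ∀ t : ℝ, (fun ξ : Rn n => ((Real.exp (-(t/2)) * Lsig (2*(k:ℝ)) t ξ : ℝ) : ℂ) *
      FT n ⇑ψ (c • ξ)) = fun ξ => (Real.exp (-(t/2)) * (t * Sf 0 (t^2/4 - t^2*‖ξ‖^(2*k)))) • χ ξ := by
    intro t
    funext ξ
    rw [← hχe]
    by_cases h : χ ξ = 0
    · simp [h]
    · rw [Lsig_eq k hk t ξ (by rw [hcinv]; exact hχ1 ξ h) (hχ2 ξ h), Complex.real_smul]
  simp only [hfun]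
  set A1 : ℝ := ∑ m ∈ Finset.range (N+1), (32 ^ (m+1) * (m+1).factorial * Real.exp (1/2)) with hA1
  obtain ⟨K1, hK1, hb1⟩ := kernel_bound n k j N hN hk χ hχ2 A1 (by positivity)
  obtain ⟨K2, hK2, hb2⟩ := kernel_bound n k j N hN hk χ hχ2 (Real.exp 1) (by positivity)
  refine ⟨K1 + K2, by positivity, fun t ht x => ⟨fun ht1 => ?_, fun ht1 => ?_⟩⟩
  · refine (IFT_norm_le n _ x).trans ?_
    have hb := hb2 (fun m s => Real.exp (-(t/2)) * ((-t^2)^m * Sf m (t^2/4 - t^2*s)))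
      (fun m s => G_hasDerivAt _ _ _ m s) 1 one_pos le_rfl
      (fun m _ s hs hs' => by
        have hst : s ≤ 1/4 := by simpa using hs'
        have h0 := Sf_nonneg m (z := t^2/4 - t^2*s) (by nlinarith [sq_nonneg t])
        rw [abs_mul, abs_mul, abs_pow, abs_neg, abs_of_nonneg (sq_nonneg t), abs_of_nonneg h0,
          abs_of_pos (Real.exp_pos _)]
        exact G_bound_small m ht ht1 hs hst) x
    have he : ∫ ξ : Rn n, ((Real.exp (-(t/2)) * (t * Sf 0 (t^2/4 - t^2*‖ξ‖^(2*k)))) • χ ξ) *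
          Complex.exp (Complex.I * (⟪ξ, x⟫ : ℝ)) =
        t • ∫ ξ : Rn n, ((Real.exp (-(t/2)) * ((-t^2)^0 * Sf 0 (t^2/4 - t^2*‖ξ‖^(2*k)))) •
          χ ((1:ℝ) • ξ)) * Complex.exp (Complex.I * (⟪ξ, x⟫ : ℝ)) := by
      rw [← integral_smul]
      congr 1
      funext ξ
      simp only [one_smul, pow_zero, one_mul, Complex.real_smul]
      push_cast
      ring
    rw [he, norm_smul, Real.norm_of_nonneg ht.le]
    have hj0 : 0 ≤ jap x ^ (-j) := Real.rpow_nonneg (Real.sqrt_nonneg _) _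
    calc _ ≤ t * (K2 * jap x ^ (-j)) := by gcongr
      _ ≤ t * ((K1 + K2) * jap x ^ (-j)) := by gcongr; linarith
      _ = _ := by ring
  · refine (IFT_norm_le n _ x).trans ?_
    set μ : ℝ := t ^ (-(1:ℝ)/(2*(k:ℝ))) with hμ
    have hμ0 : 0 < μ := by positivity
    have hμ1 : μ ≤ 1 := Real.rpow_le_one_of_one_le_of_nonpos ht1
      (div_nonpos_of_nonpos_of_nonneg (by norm_num) (by positivity))
    have hμk : μ^(2*k) = t⁻¹ := by
      rw [hμ, ← Real.rpow_natCast, ← Real.rpow_mul ht.le]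
      push_cast
      rw [div_mul_cancel₀ _ (by positivity), Real.rpow_neg_one]
    have hμn : μ^n = t ^ (-(n:ℝ)/(2*(k:ℝ))) := by
      rw [hμ, ← Real.rpow_natCast, ← Real.rpow_mul ht.le]
      congr 1; ring
    have hb := hb1 (fun m s => Real.exp (-(t/2)) * t * ((-t)^m * Sf m (t^2/4 - t*s)))
      (fun m s => G_hasDerivAt _ _ _ m s) μ hμ0 hμ1
      (fun m hm s hs hs' => by
        rw [hμk, inv_mul_le_iff₀ ht] at hs'
        have hst : s ≤ t/4 := by linarith
        have h0 := Sf_nonneg m (z := t^2/4 - t*s) (by nlinarith)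
        rw [abs_mul, abs_mul _ (Sf m _), abs_pow, abs_neg, abs_of_pos ht, abs_of_nonneg h0,
          abs_of_pos (mul_pos (Real.exp_pos _) ht)]
        refine (G_bound_large m ht1 hs hst).trans ?_
        refine mul_le_mul_of_nonneg_right ?_ (Real.exp_pos _).le
        exact Finset.single_le_sum
          (f := fun m : ℕ => (32:ℝ) ^ (m+1) * (m+1).factorial * Real.exp (1/2))
          (fun _ _ => by positivity) (Finset.mem_range.2 (by omega))) (μ • x)
    have hcv := Measure.integral_comp_smul (volume : Measure (Rn n))
      (fun ξ : Rn n => ((Real.exp (-(t/2)) * (t * Sf 0 (t^2/4 - t^2*‖ξ‖^(2*k)))) • χ ξ) *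
          Complex.exp (Complex.I * (⟪ξ, x⟫ : ℝ))) μ
    have he : (fun η : Rn n => ((Real.exp (-(t/2)) * t * ((-t)^0 * Sf 0 (t^2/4 - t*‖η‖^(2*k)))) •
          χ (μ • η)) * Complex.exp (Complex.I * (⟪η, μ • x⟫ : ℝ))) = fun η : Rn n =>
        ((Real.exp (-(t/2)) * (t * Sf 0 (t^2/4 - t^2*‖μ • η‖^(2*k)))) • χ (μ • η)) *
          Complex.exp (Complex.I * (⟪μ • η, x⟫ : ℝ)) := by
      funext η
      have e1 : t^2 * ‖μ • η‖^(2*k) = t * ‖η‖^(2*k) := by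
        rw [norm_smul, mul_pow, Real.norm_of_nonneg hμ0.le, hμk]
        field_simp
      rw [e1, real_inner_smul_left, real_inner_smul_right, pow_zero, one_mul, mul_assoc]
    simp only [he] at hb
    rw [hcv, finrank_euclideanSpace_fin, norm_smul, Real.norm_eq_abs, abs_abs,
      abs_of_pos (by positivity), inv_mul_le_iff₀ (by positivity)] at hb
    refine hb.trans ?_
    rw [hμn]
    have hj0 : 0 ≤ jap (μ • x) ^ (-j) := Real.rpow_nonneg (Real.sqrt_nonneg _) _
    have hp0 : 0 ≤ t ^ (-(n:ℝ)/(2*(k:ℝ))) := by positivity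
    calc _ ≤ t ^ (-(n:ℝ)/(2*(k:ℝ))) * ((K1 + K2) * jap (μ • x) ^ (-j)) := by gcongr; linarith
      _ = _ := by ring

end
end
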